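/- arXiv:2204.00936 — 2 statements merged into one kernel-verified Lean document; each statement's English description precedes it below -/
import Mathlib

section
/- Let X be a real vector space with dim X = 3, K ⊂ X a convex body with 0 in its interior, and R : X* → End(X) a linear map with tr R(λ) = 0 for all λ ∈ X*, satisfying the tangency assumption: for every λ ∈ X* and every x ∈ ∂K with λ(x) = 0, the vector R_λ(x) is tangent to ∂K at x. Assume there exist p₀, p₁ ∈ X∖{0} such that R is degenerate at p₀ (dim T^R_{p₀} ≤ 1) and non-degenerate at p₁ (dim T^R_{p₁} = 2). Then K is an ellipsoid centered at 0. -/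
open Filter Topology

/-- `v` is *forward tangent* to `∂B` at `x` if there are a sequence `p i ∈ ∂B` with `p i → x`
and positive reals `c i` with `c i • (p i - x) → v`. -/
def IsForwardTangent {X : Type*} [NormedAddCommGroup X] [NormedSpace ℝ X]
    (B : Set X) (x v : X) : Prop :=
  ∃ (p : ℕ → X) (c : ℕ → ℝ), (∀ i, p i ∈ frontier B) ∧ (∀ i, 0 < c i) ∧
    Tendsto p atTop (𝓝 x) ∧ Tendsto (fun i => c i • (p i - x)) atTop (𝓝 v)

/-- `v` is *tangent* to `∂B` at `x` if both `v` and `-v` are forward tangent to `∂B` at `x`. -/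
def IsTangentVec {X : Type*} [NormedAddCommGroup X] [NormedSpace ℝ X]
    (B : Set X) (x v : X) : Prop :=
  IsForwardTangent B x v ∧ IsForwardTangent B x (-v)

/-- For a linear map `R : X* → End(X)` and `p ∈ X`, the set
`T^R_p = {R_λ(p) : λ ∈ X*, λ(p) = 0}`. -/
def TR {X : Type*} [AddCommGroup X] [Module ℝ X]
    (R : Module.Dual ℝ X →ₗ[ℝ] (X →ₗ[ℝ] X)) (p : X) : Set X :=
  {y | ∃ lam : Module.Dual ℝ X, lam p = 0 ∧ R lam p = y}

/-- A set is an *ellipsoid centered at `0`* if it is the unit ball of an inner-product norm,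
i.e. `{x | f x x ≤ 1}` for a symmetric positive definite bilinear form `f`. -/
def IsEllipsoid {X : Type*} [AddCommGroup X] [Module ℝ X] (K : Set X) : Prop :=
  ∃ f : X →ₗ[ℝ] X →ₗ[ℝ] ℝ, (∀ x y, f x y = f y x) ∧ (∀ x, x ≠ 0 → 0 < f x x) ∧
    K = {x | f x x ≤ 1}


lemma countable_lin_zero (a b : ℝ) (h : a ≠ 0 ∨ b ≠ 0) :
    {θ : ℝ | a * Real.cos θ + b * Real.sin θ = 0}.Countable := by
  set c : ℂ := ⟨a, b⟩ with hc
  have hc0 : c ≠ 0 := by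
    intro h0
    have h1 := congrArg Complex.re h0
    have h2 := congrArg Complex.im h0
    simp [hc] at h1 h2
    tauto
  have e1 : ‖c‖ * Real.cos (Complex.arg c) = a := Complex.norm_mul_cos_arg c
  have e2 : ‖c‖ * Real.sin (Complex.arg c) = b := Complex.norm_mul_sin_arg c
  have hn : ‖c‖ ≠ 0 := norm_ne_zero_iff.mpr hc0
  refine (Set.countable_range (fun k : ℤ => (2 * (k : ℝ) + 1) * Real.pi / 2 + Complex.arg c)).mono ?_
  intro θ hθ
  have hθ' : a * Real.cos θ + b * Real.sin θ = 0 := hθ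
  have : Real.cos (θ - Complex.arg c) = 0 := by
    rw [Real.cos_sub]
    have : ‖c‖ * (Real.cos θ * Real.cos c.arg + Real.sin θ * Real.sin c.arg) = 0 := by
      rw [← hθ', ← e1, ← e2]; simp only [e1, e2]; rw [mul_add]; 
      rw [show ‖c‖ * (Real.cos θ * Real.cos c.arg) = (‖c‖ * Real.cos c.arg) * Real.cos θ by ring,
        show ‖c‖ * (Real.sin θ * Real.sin c.arg) = (‖c‖ * Real.sin c.arg) * Real.sin θ by ring, e1, e2]
    exact (mul_eq_zero.mp this).resolve_left hn
  obtain ⟨k, hk⟩ := Real.cos_eq_zero_iff.mp this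
  exact ⟨k, by simp only; linarith⟩

lemma circ (H : ℝ → ℝ → ℝ) (hc : Continuous fun p : ℝ × ℝ => H p.1 p.2)
    (hhom : ∀ s z t, 0 ≤ s → H (s * z) (s * t) = s * H z t)
    (hpos : ∀ z t, (z ≠ 0 ∨ t ≠ 0) → 0 < H z t) (α β γ δ : ℝ)
    (hq : ∀ z t, (z ≠ 0 ∨ t ≠ 0) → 0 < z * (α * z + β * t) + t * (γ * z + δ * t))
    (a1 b1 a2 b2 : ℝ) (h1 : a1 ≠ 0 ∨ b1 ≠ 0) (h2 : a2 ≠ 0 ∨ b2 ≠ 0)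
    (hder : ∀ z t a b, (a1 * z + b1 * t) * (a2 * z + b2 * t) ≠ 0 →
      HasDerivAt (fun s => H (z + s * a) (t + s * b))
        (H z t * (a * (α * z + β * t) + b * (γ * z + δ * t)) /
          (z * (α * z + β * t) + t * (γ * z + δ * t))) 0) :
    ∃ A B C, ∀ z t, H z t ^ 2 = A * z ^ 2 + B * z * t + C * t ^ 2 := by
  set q : ℝ → ℝ := fun θ => Real.cos θ * (α * Real.cos θ + β * Real.sin θ) +
    Real.sin θ * (γ * Real.cos θ + δ * Real.sin θ) with hqd
  have cs : ∀ θ, Real.cos θ ≠ 0 ∨ Real.sin θ ≠ 0 := by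
    intro θ
    by_contra! h
    have := Real.cos_sq_add_sin_sq θ
    rw [h.1, h.2] at this; norm_num at this
  have q0 : ∀ θ, 0 < q θ := fun θ => hq _ _ (cs θ)
  have H0 : ∀ θ, 0 < H (Real.cos θ) (Real.sin θ) := fun θ => hpos _ _ (cs θ)
  have Hc : Continuous fun θ : ℝ => H (Real.cos θ) (Real.sin θ) :=
    hc.comp (Real.continuous_cos.prodMk Real.continuous_sin)
  have qc : Continuous q := by fun_prop
  set u : ℝ → ℝ := fun θ => Real.log (H (Real.cos θ) (Real.sin θ)) - Real.log (q θ) / 2 with hu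
  have uc : Continuous u :=
    (Hc.log fun θ => (H0 θ).ne').sub ((qc.log fun θ => (q0 θ).ne').div_const 2)
  set κ := (γ - β) / 2 with hκ
  set S := {θ : ℝ | a1 * Real.cos θ + b1 * Real.sin θ = 0} ∪
    {θ : ℝ | a2 * Real.cos θ + b2 * Real.sin θ = 0} with hS
  have Sc : S.Countable := (countable_lin_zero _ _ h1).union (countable_lin_zero _ _ h2)
  have hud : ∀ θ, θ ∉ S → HasDerivAt u (κ / q θ) θ := by
    intro θ hθ
    have hne : (a1 * Real.cos θ + b1 * Real.sin θ) * (a2 * Real.cos θ + b2 * Real.sin θ) ≠ 0 := by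
      intro h; apply hθ; rcases mul_eq_zero.mp h with h | h
      · left; exact h
      · right; exact h
    have hd := hder (Real.cos θ) (Real.sin θ) (-Real.sin θ) (Real.cos θ) hne
    -- tangent reparametrization
    have htan : HasDerivAt (fun φ : ℝ => Real.tan (φ - θ)) 1 θ := by
      have := HasDerivAt.comp (h := fun φ : ℝ => φ - θ) θ (Real.hasDerivAt_tan (x := θ - θ) (by simp)) ((hasDerivAt_id θ).sub_const θ)
      simpa [Function.comp_def] using this
    have hcos : HasDerivAt (fun φ : ℝ => Real.cos (φ - θ)) 0 θ := by
      have := HasDerivAt.comp (h := fun φ : ℝ => φ - θ) θ (Real.hasDerivAt_cos (θ - θ)) ((hasDerivAt_id θ).sub_const θ)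
      simpa [Function.comp_def] using this
    have hd' := HasDerivAt.comp (h₂ := fun s => H (Real.cos θ + s * (-Real.sin θ)) (Real.sin θ + s * Real.cos θ)) θ
      (by simpa using hd) htan
    have hprod := hcos.mul hd'
    have hH : HasDerivAt (fun φ => H (Real.cos φ) (Real.sin φ))
      (H (Real.cos θ) (Real.sin θ) * (-Real.sin θ * (α * Real.cos θ + β * Real.sin θ) + Real.cos θ * (γ * Real.cos θ + δ * Real.sin θ)) / q θ) θ := by
      have : (fun φ => H (Real.cos φ) (Real.sin φ)) =ᶠ[𝓝 θ] ((fun φ => Real.cos (φ - θ)) *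
      (fun s => H (Real.cos θ + s * -Real.sin θ) (Real.sin θ + s * Real.cos θ)) ∘ fun φ => Real.tan (φ - θ)) := by
        have hev : ∀ᶠ φ in 𝓝 θ, 0 < Real.cos (φ - θ) := by
          have : Continuous fun φ : ℝ => Real.cos (φ - θ) := by fun_prop
          exact (this.tendsto θ).eventually (lt_mem_nhds (by simp))
        filter_upwards [hev] with φ hφ
        simp only [Pi.mul_apply, Function.comp]
        rw [← hhom _ _ _ hφ.le, Real.tan_eq_sin_div_cos]
        have e1 : Real.cos φ = Real.cos (φ - θ) * (Real.cos θ + Real.sin (φ - θ) / Real.cos (φ - θ) * -Real.sin θ) := by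
          field_simp
          have := Real.cos_add (φ - θ) θ
          rw [sub_add_cancel] at this; rw [this]; ring
        have e2 : Real.sin φ = Real.cos (φ - θ) * (Real.sin θ + Real.sin (φ - θ) / Real.cos (φ - θ) * Real.cos θ) := by
          field_simp
          have := Real.sin_add (φ - θ) θ
          rw [sub_add_cancel] at this; rw [this]; ring
        rw [← e1, ← e2]
      refine (hprod.congr_of_eventuallyEq this).congr_deriv ?_
      simp [hqd]
    have hqD : HasDerivAt q (2 * (-α * Real.cos θ * Real.sin θ - (β + γ) / 2 * Real.sin θ ^ 2 + (β + γ) / 2 * Real.cos θ ^ 2 + δ * Real.cos θ * Real.sin θ)) θ := by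
      have c := Real.hasDerivAt_cos θ
      have s := Real.hasDerivAt_sin θ
      have := (c.mul ((c.const_mul α).add (s.const_mul β))).add (s.mul ((c.const_mul γ).add (s.const_mul δ)))
      refine HasDerivAt.congr_deriv (f := q) this ?_
      simp only [Pi.add_apply]
      ring
    have := (hH.log (H0 θ).ne').sub ((hqD.log (q0 θ).ne').div_const 2)
    refine HasDerivAt.congr_deriv (f := u) this ?_
    have := (H0 θ).ne'
    have := (q0 θ).ne'
    field_simp
    rw [hκ]
    linear_combination (γ - β) * Real.cos_sq_add_sin_sq θ
  have hinteg : ∀ a b, a ≤ b → ∫ θ in a..b, κ / q θ = u b - u a := by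
    intro a b hab
    exact MeasureTheory.integral_eq_of_hasDerivAt_off_countable_of_le _ _ hab Sc uc.continuousOn
      (fun θ hθ => hud θ hθ.2) ((continuous_const.div qc fun θ => (q0 θ).ne').intervalIntegrable _ _)
  have hk0 : κ = 0 := by
    have h := hinteg 0 (2 * Real.pi) (by positivity)
    have : u (2 * Real.pi) = u 0 := by simp [hu, hqd]
    rw [this, sub_self] at h
    have hp : 0 < ∫ θ in (0:ℝ)..(2 * Real.pi), 1 / q θ :=
      intervalIntegral.intervalIntegral_pos_of_pos
        ((continuous_const.div qc fun θ => (q0 θ).ne').intervalIntegrable _ _)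
        (fun θ => by have := q0 θ; positivity) (by positivity)
    have : ∫ θ in (0:ℝ)..(2 * Real.pi), κ / q θ = κ * ∫ θ in (0:ℝ)..(2 * Real.pi), 1 / q θ := by
      rw [← intervalIntegral.integral_const_mul]; congr 1; ext; ring
    rw [this] at h
    exact (mul_eq_zero.mp h).resolve_right hp.ne'
  have hconst : ∀ θ, u θ = u 0 := by
    intro θ
    rcases le_total 0 θ with h | h
    · have := hinteg 0 θ h
      simp [hk0] at this; linarith
    · have := hinteg θ 0 h
      simp [hk0] at this; linarith
  set E := Real.exp (2 * u 0) with hE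
  have hsq : ∀ θ, H (Real.cos θ) (Real.sin θ) ^ 2 = E * q θ := by
    intro θ
    have h := hconst θ
    have : 2 * u 0 = Real.log (H (Real.cos θ) (Real.sin θ) ^ 2) - Real.log (q θ) := by
      rw [← h, Real.log_pow]; simp only [hu]; push_cast; ring
    rw [hE, this, Real.exp_sub, Real.exp_log (by have := H0 θ; positivity), Real.exp_log (q0 θ)]
    have := (q0 θ).ne'
    field_simp
  refine ⟨E * α, E * (β + γ), E * δ, ?_⟩
  intro z t
  set c : ℂ := ⟨z, t⟩ with hcd
  have e1 : ‖c‖ * Real.cos (Complex.arg c) = z := Complex.norm_mul_cos_arg c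
  have e2 : ‖c‖ * Real.sin (Complex.arg c) = t := Complex.norm_mul_sin_arg c
  have := hsq (Complex.arg c)
  have hh := hhom ‖c‖ (Real.cos c.arg) (Real.sin c.arg) (norm_nonneg _)
  rw [e1, e2] at hh
  rw [hh, mul_pow, this]
  simp only [hqd]
  have : E * α * z ^ 2 + E * (β + γ) * z * t + E * δ * t ^ 2 = E * (z * (α * z + β * t) + t * (γ * z + δ * t)) := by ring
  rw [this]
  conv_rhs => rw [← e1, ← e2]
  ring


lemma nonneg_at_zero (φ : ℝ → ℝ) (hφ : Continuous φ) (h : ∀ s, s ≠ 0 → 0 ≤ φ s) : 0 ≤ φ 0 := by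
  have h1 : Tendsto φ (𝓝[≠] 0) (𝓝 (φ 0)) := (hφ.tendsto 0).mono_left nhdsWithin_le_nhds
  refine ge_of_tendsto h1 ?_
  filter_upwards [self_mem_nhdsWithin] with s hs using h s hs

lemma div_bound (f g H : ℝ → ℝ → ℝ) (hf : Continuous fun p : ℝ × ℝ => f p.1 p.2)
    (hg : Continuous fun p : ℝ × ℝ => g p.1 p.2) (hH : Continuous fun p : ℝ × ℝ => H p.1 p.2)
    (a b C : ℝ) (hab : a ≠ 0 ∨ b ≠ 0)
    (h : ∀ z t, |(a * z + b * t) * f z t| * H z t ≤ C * |(a * z + b * t) * g z t|) :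
    ∀ z t, |f z t| * H z t ≤ C * |g z t| := by
  have key : ∀ z t, a * z + b * t ≠ 0 → |f z t| * H z t ≤ C * |g z t| := by
    intro z t hl
    have h1 := h z t
    rw [abs_mul, abs_mul] at h1
    have h2 : 0 < |a * z + b * t| := abs_pos.mpr hl
    have h3 : |a * z + b * t| * (|f z t| * H z t) ≤ |a * z + b * t| * (C * |g z t|) := by linarith
    exact le_of_mul_le_mul_left h3 h2
  intro z t
  by_cases hl : a * z + b * t = 0
  · have hp : Continuous fun s : ℝ => ((z + s * a, t + s * b) : ℝ × ℝ) := by fun_prop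
    have := nonneg_at_zero (fun s => C * |g (z + s * a) (t + s * b)| -
      |f (z + s * a) (t + s * b)| * H (z + s * a) (t + s * b))
      ((continuous_const.mul (hg.comp hp).abs).sub ((hf.comp hp).abs.mul (hH.comp hp))) (by
        intro s hs
        have hne : a * (z + s * a) + b * (t + s * b) ≠ 0 := by
          have : a * (z + s * a) + b * (t + s * b) = s * (a ^ 2 + b ^ 2) := by linear_combination hl
          rw [this]
          have : 0 < a ^ 2 + b ^ 2 := by
            rcases hab with h | h
            · have := sq_pos_of_ne_zero h; positivity
            · have := sq_pos_of_ne_zero h; positivity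
          exact mul_ne_zero hs this.ne'
        have := key _ _ hne
        linarith)
    simp at this
    linarith
  · exact key z t hl

lemma quad_factor (a b c u w : ℝ) (huw : u ≠ 0 ∨ w ≠ 0)
    (h : a * u ^ 2 + b * u * w + c * w ^ 2 = 0) :
    ∃ p r, ∀ z t, a * z ^ 2 + b * z * t + c * t ^ 2 = (w * z - u * t) * (p * z + r * t) := by
  by_cases hw : w = 0
  · have hu : u ≠ 0 := by tauto
    subst hw
    have ha : a = 0 := by
      have : a * u ^ 2 = 0 := by linarith
      exact (mul_eq_zero.mp this).resolve_right (pow_ne_zero _ hu)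
    refine ⟨-b / u, -c / u, fun z t => ?_⟩
    subst ha
    field_simp
    ring
  · refine ⟨a / w, (b + u * a / w) / w, fun z t => ?_⟩
    have hc : c = -(a * u ^ 2 + b * u * w) / w ^ 2 := by field_simp; linarith
    rw [hc]; field_simp; ring

lemma lin_factor (p r u w : ℝ) (huw : u ≠ 0 ∨ w ≠ 0) (h : p * u + r * w = 0) :
    ∃ c, ∀ z t, p * z + r * t = (w * z - u * t) * c := by
  by_cases hw : w = 0
  · have hu : u ≠ 0 := by tauto
    subst hw
    have hp : p = 0 := by
      have : p * u = 0 := by linarith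
      exact (mul_eq_zero.mp this).resolve_right hu
    refine ⟨-r / u, fun z t => ?_⟩
    subst hp
    field_simp
    ring
  · refine ⟨p / w, fun z t => ?_⟩
    have hr : r = -(p * u) / w := by field_simp; linarith
    rw [hr]; field_simp; ring

lemma cubic_root (c : ℝ → ℝ → ℝ) (hc : Continuous fun p : ℝ × ℝ => c p.1 p.2)
    (hodd : ∀ z t, c (-z) (-t) = - c z t) : ∃ u w, (u ≠ 0 ∨ w ≠ 0) ∧ c u w = 0 := by
  have hcont : Continuous fun θ : ℝ => c (Real.cos θ) (Real.sin θ) :=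
    hc.comp (Real.continuous_cos.prodMk Real.continuous_sin)
  have h1 : c (Real.cos Real.pi) (Real.sin Real.pi) = - c (Real.cos 0) (Real.sin 0) := by
    rw [← hodd]; simp
  have hex : ∃ θ : ℝ, c (Real.cos θ) (Real.sin θ) = 0 := by
    rcases le_total 0 (c (Real.cos 0) (Real.sin 0)) with h | h
    · exact mem_range_of_exists_le_of_exists_ge hcont ⟨Real.pi, by linarith⟩ ⟨0, h⟩
    · exact mem_range_of_exists_le_of_exists_ge hcont ⟨0, h⟩ ⟨Real.pi, by linarith⟩
  obtain ⟨θ, hθ⟩ := hex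
  refine ⟨_, _, ?_, hθ⟩
  by_contra! h
  have := Real.cos_sq_add_sin_sq θ
  rw [h.1, h.2] at this; norm_num at this

lemma section_quad (H : ℝ → ℝ → ℝ) (hc : Continuous fun p : ℝ × ℝ => H p.1 p.2)
    (hhom : ∀ s z t, 0 ≤ s → H (s * z) (s * t) = s * H z t)
    (hpos : ∀ z t, (z ≠ 0 ∨ t ≠ 0) → 0 < H z t) (a1 a2 a3 b1 b2 b3 C : ℝ)
    (k1 k2 q : ℝ → ℝ → ℝ) (hk1 : ∀ z t, k1 z t = a1 * z ^ 2 + a2 * z * t + a3 * t ^ 2)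
    (hk2 : ∀ z t, k2 z t = b1 * z ^ 2 + b2 * z * t + b3 * t ^ 2)
    (hq : ∀ z t, q z t = t * (z * k1 z t + t * k2 z t))
    (hb1 : ∀ z t, |t * k1 z t| * H z t ≤ C * |q z t|)
    (hb2 : ∀ z t, |t * k2 z t| * H z t ≤ C * |q z t|)
    (hne : ∃ z t, q z t ≠ 0)
    (hder : ∀ z t a b, q z t ≠ 0 → HasDerivAt (fun s => H (z + s * a) (t + s * b))
      (H z t * (a * (t * k1 z t) + b * (t * k2 z t)) / q z t) 0) :
    ∃ A B C, ∀ z t, H z t ^ 2 = A * z ^ 2 + B * z * t + C * t ^ 2 := by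
  obtain rfl : k1 = fun z t => a1 * z ^ 2 + a2 * z * t + a3 * t ^ 2 := by ext z t; exact hk1 z t
  obtain rfl : k2 = fun z t => b1 * z ^ 2 + b2 * z * t + b3 * t ^ 2 := by ext z t; exact hk2 z t
  obtain rfl : q = fun z t => _ := by ext z t; exact hq z t
  clear hk1 hk2 hq
  simp only at *
  set c : ℝ → ℝ → ℝ := fun z t => z * (a1 * z ^ 2 + a2 * z * t + a3 * t ^ 2) +
    t * (b1 * z ^ 2 + b2 * z * t + b3 * t ^ 2) with hcdef
  have hb1' := div_bound (fun z t => a1 * z ^ 2 + a2 * z * t + a3 * t ^ 2) c H (by fun_prop)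
    (by simp only [hcdef]; fun_prop) hc 0 1 C (by norm_num) (by intro z t; simpa [hcdef] using hb1 z t)
  have hb2' := div_bound (fun z t => b1 * z ^ 2 + b2 * z * t + b3 * t ^ 2) c H (by fun_prop)
    (by simp only [hcdef]; fun_prop) hc 0 1 C (by norm_num) (by intro z t; simpa [hcdef] using hb2 z t)
  obtain ⟨u, w, huw, hroot⟩ := cubic_root c (by simp only [hcdef]; fun_prop)
    (by intro z t; simp only [hcdef]; ring)
  have zero_of : ∀ x z t, (z ≠ 0 ∨ t ≠ 0) → |x| * H z t ≤ C * |(0:ℝ)| → x = 0 := by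
    intro x z t hzt hx
    have h1 := hpos z t hzt
    rw [abs_zero, mul_zero] at hx
    have h2 : |x| ≤ 0 := by
      by_contra hh
      push Not at hh
      have := mul_pos hh h1
      linarith
    exact abs_nonpos_iff.mp h2
  have r1 := zero_of _ u w huw (hroot ▸ hb1' u w)
  have r2 := zero_of _ u w huw (hroot ▸ hb2' u w)
  obtain ⟨p1, r1, hf1⟩ := quad_factor _ _ _ _ _ huw r1
  obtain ⟨p2, r2, hf2⟩ := quad_factor _ _ _ _ _ huw r2
  have hwu : w ≠ 0 ∨ -u ≠ 0 := by rcases huw with h | h <;> simp [h]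
  set q' : ℝ → ℝ → ℝ := fun z t => z * (p1 * z + r1 * t) + t * (p2 * z + r2 * t) with hq'
  have hcq : ∀ z t, c z t = (w * z - u * t) * q' z t := by
    intro z t; simp only [hcdef, hq', hf1, hf2]; ring
  have hq'c : Continuous fun p : ℝ × ℝ => q' p.1 p.2 := by simp only [hq']; fun_prop
  have hd1 := div_bound (fun z t => p1 * z + r1 * t) q' H (by fun_prop) hq'c hc w (-u) C hwu (by
    intro z t
    have := hb1' z t
    simp only [hf1, hcq] at this
    rw [show w * z + -u * t = w * z - u * t by ring]; exact this)
  have hd2 := div_bound (fun z t => p2 * z + r2 * t) q' H (by fun_prop) hq'c hc w (-u) C hwu (by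
    intro z t
    have := hb2' z t
    simp only [hf2, hcq] at this
    rw [show w * z + -u * t = w * z - u * t by ring]; exact this)
  have hnoroot : ∀ z t, (z ≠ 0 ∨ t ≠ 0) → q' z t ≠ 0 := by
    intro u' w' hu' h0
    have s1 := zero_of _ u' w' hu' (h0 ▸ hd1 u' w')
    have s2 := zero_of _ u' w' hu' (h0 ▸ hd2 u' w')
    obtain ⟨c1, hc1⟩ := lin_factor _ _ _ _ hu' s1
    obtain ⟨c2, hc2⟩ := lin_factor _ _ _ _ hu' s2
    have hwu' : w' ≠ 0 ∨ -u' ≠ 0 := by rcases hu' with h | h <;> simp [h]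
    have hqf : ∀ z t, q' z t = (w' * z - u' * t) * (z * c1 + t * c2) := by
      intro z t; simp only [hq', hc1, hc2]; ring
    have he1 := div_bound (fun z t => c1) (fun z t => z * c1 + t * c2) H (by fun_prop) (by fun_prop) hc
      w' (-u') C hwu' (by
        intro z t
        have := hd1 z t
        simp only [hc1, hqf] at this
        rw [show w' * z + -u' * t = w' * z - u' * t by ring]; exact this)
    have he2 := div_bound (fun z t => c2) (fun z t => z * c1 + t * c2) H (by fun_prop) (by fun_prop) hc
      w' (-u') C hwu' (by
        intro z t
        have := hd2 z t
        simp only [hc2, hqf] at this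
        rw [show w' * z + -u' * t = w' * z - u' * t by ring]; exact this)
    have hcc : ¬ (c2 ≠ 0 ∨ -c1 ≠ 0) := by
      intro hcc
      have e : c2 * c1 + -c1 * c2 = 0 := by ring
      have f1 := zero_of _ c2 (-c1) hcc (e ▸ he1 c2 (-c1))
      have f2 := zero_of _ c2 (-c1) hcc (e ▸ he2 c2 (-c1))
      simp [f1, f2] at hcc
    push Not at hcc
    obtain ⟨z, t, hzt⟩ := hne
    apply hzt
    have := hcq z t
    rw [hqf, hcc.1, show c1 = 0 by linarith [hcc.2]] at this
    have h3 : c z t = 0 := by rw [this]; ring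
    simp only [hcdef] at h3
    rw [h3, mul_zero]
  have hp1 : p1 ≠ 0 := by
    have := hnoroot 1 0 (by norm_num)
    simpa [hq'] using this
  have hdisc : (r1 + p2) ^ 2 - 4 * p1 * r2 < 0 := by
    by_contra! hD
    apply hnoroot ((-(r1 + p2) + Real.sqrt ((r1 + p2) ^ 2 - 4 * p1 * r2)) / (2 * p1)) 1 (by norm_num)
    have hs := Real.sq_sqrt hD
    simp only [hq']
    set S := Real.sqrt ((r1 + p2) ^ 2 - 4 * p1 * r2)
    field_simp
    linear_combination hs
  have hpq : ∀ z t, (z ≠ 0 ∨ t ≠ 0) → 0 < p1 * q' z t := by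
    intro z t hzt
    have e : 4 * (p1 * q' z t) = (2 * p1 * z + (r1 + p2) * t) ^ 2 + (4 * p1 * r2 - (r1 + p2) ^ 2) * t ^ 2 := by
      simp only [hq']; ring
    have h1 : 0 ≤ 4 * (p1 * q' z t) := by
      rw [e]
      have : 0 ≤ (4 * p1 * r2 - (r1 + p2) ^ 2) * t ^ 2 := mul_nonneg (by linarith) (sq_nonneg _)
      positivity
    have h2 : p1 * q' z t ≠ 0 := mul_ne_zero hp1 (hnoroot z t hzt)
    exact lt_of_le_of_ne (by linarith) h2.symm
  refine circ H hc hhom hpos (p1 * p1) (p1 * r1) (p1 * p2) (p1 * r2) ?_ 0 1 w (-u) (by norm_num) hwu ?_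
  · intro z t hzt
    have := hpq z t hzt
    simp only [hq'] at this
    linarith
  · intro z t a b hl
    have ht : t ≠ 0 := by
      intro h; apply hl; rw [h]; ring
    have hl2 : w * z - u * t ≠ 0 := by
      intro h; apply hl; rw [show w * z + -u * t = w * z - u * t by ring, h]; ring
    have hq0 := hnoroot z t (Or.inr ht)
    have hcz := hcq z t
    have := hder z t a b (by
      have : c z t ≠ 0 := by rw [hcz]; exact mul_ne_zero hl2 hq0
      exact mul_ne_zero ht this)
    refine this.congr_deriv ?_
    have e : z * (p1 * p1 * z + p1 * r1 * t) + t * (p1 * p2 * z + p1 * r2 * t) = p1 * q' z t := by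
      simp only [hq']; ring
    rw [e, show z * (a1 * z ^ 2 + a2 * z * t + a3 * t ^ 2) +
      t * (b1 * z ^ 2 + b2 * z * t + b3 * t ^ 2) = (w * z - u * t) * q' z t from hcz, hf1, hf2]
    rw [div_eq_div_iff (by positivity) (by positivity)]
    ring

lemma lin_cancel (E : ℝ → ℝ → ℝ) (hE : Continuous fun p : ℝ × ℝ => E p.1 p.2) (a b : ℝ)
    (hab : a ≠ 0 ∨ b ≠ 0) (h : ∀ x y, (a * x + b * y) * E x y = 0) : ∀ x y, E x y = 0 := by
  intro x y
  by_cases hl : a * x + b * y = 0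
  · have hpos : 0 < a ^ 2 + b ^ 2 := by
      rcases hab with h | h
      · have := sq_pos_of_ne_zero h; positivity
      · have := sq_pos_of_ne_zero h; positivity
    have key : ∀ s : ℝ, s ≠ 0 → E (x + s * a) (y + s * b) = 0 := by
      intro s hs
      have h1 := h (x + s * a) (y + s * b)
      have h2 : a * (x + s * a) + b * (y + s * b) = s * (a ^ 2 + b ^ 2) := by
        linear_combination hl
      rw [h2] at h1
      exact (mul_eq_zero.mp h1).resolve_left (mul_ne_zero hs hpos.ne')
    have hcont : Continuous fun s : ℝ => E (x + s * a) (y + s * b) :=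
      hE.comp (f := fun s : ℝ => (x + s * a, y + s * b)) (by fun_prop)
    have h1 := nonneg_at_zero _ hcont (fun s hs => (key s hs).ge)
    have h2 := nonneg_at_zero _ hcont.neg (fun s hs => by simp [key s hs])
    simp at h1 h2
    linarith
  · exact (mul_eq_zero.mp (h x y)).resolve_left hl

lemma cubic_factor (a b c d u w : ℝ) (huw : u ≠ 0 ∨ w ≠ 0)
    (h : a * u ^ 3 + b * u ^ 2 * w + c * u * w ^ 2 + d * w ^ 3 = 0) :
    ∃ p q r, ∀ z t, a * z ^ 3 + b * z ^ 2 * t + c * z * t ^ 2 + d * t ^ 3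
      = (w * z - u * t) * (p * z ^ 2 + q * z * t + r * t ^ 2) := by
  by_cases hw : w = 0
  · have hu : u ≠ 0 := by tauto
    subst hw
    have ha : a = 0 := by
      have : a * u ^ 3 = 0 := by linarith
      exact (mul_eq_zero.mp this).resolve_right (pow_ne_zero _ hu)
    refine ⟨-b / u, -c / u, -d / u, fun z t => ?_⟩
    subst ha
    field_simp
    ring
  · refine ⟨a / w, (b + u * a / w) / w, (c + u * ((b + u * a / w) / w)) / w, fun z t => ?_⟩
    have hd : d = -(a * u ^ 3 + b * u ^ 2 * w + c * u * w ^ 2) / w ^ 3 := by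
      field_simp; linarith
    rw [hd]; field_simp; ring

lemma quartic_factor (a b c d e u w : ℝ) (huw : u ≠ 0 ∨ w ≠ 0)
    (h : a * u ^ 4 + b * u ^ 3 * w + c * u ^ 2 * w ^ 2 + d * u * w ^ 3 + e * w ^ 4 = 0) :
    ∃ p q r s, ∀ z t, a * z ^ 4 + b * z ^ 3 * t + c * z ^ 2 * t ^ 2 + d * z * t ^ 3 + e * t ^ 4
      = (w * z - u * t) * (p * z ^ 3 + q * z ^ 2 * t + r * z * t ^ 2 + s * t ^ 3) := by
  by_cases hw : w = 0
  · have hu : u ≠ 0 := by tauto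
    subst hw
    have ha : a = 0 := by
      have : a * u ^ 4 = 0 := by linarith
      exact (mul_eq_zero.mp this).resolve_right (pow_ne_zero _ hu)
    refine ⟨-b / u, -c / u, -d / u, -e / u, fun z t => ?_⟩
    subst ha
    field_simp
    ring
  · refine ⟨a / w, (b + u * a / w) / w, (c + u * ((b + u * a / w) / w)) / w,
      (d + u * ((c + u * ((b + u * a / w) / w)) / w)) / w, fun z t => ?_⟩
    have hd : e = -(a * u ^ 4 + b * u ^ 3 * w + c * u ^ 2 * w ^ 2 + d * u * w ^ 3) / w ^ 4 := by
      field_simp; linarith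
    rw [hd]; field_simp; ring

lemma quad_caseA (G : ℝ → ℝ → ℝ) (hG : Continuous fun p : ℝ × ℝ => G p.1 p.2) (a b : ℝ)
    (hab : a ≠ 0 ∨ b ≠ 0) (c1 c2 c3 c4 : ℝ)
    (h : ∀ x y, G x y * (a * x + b * y) = c1 * x ^ 3 + c2 * x ^ 2 * y + c3 * x * y ^ 2 + c4 * y ^ 3) :
    ∃ a b c, ∀ x y, G x y = a * x ^ 2 + b * x * y + c * y ^ 2 := by
  obtain ⟨p, q, r, hf⟩ := cubic_factor c1 c2 c3 c4 (-b) a (by simpa using hab.symm) (by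
    rw [← h]; ring)
  refine ⟨p, q, r, ?_⟩
  have := lin_cancel (fun x y => G x y - (p * x ^ 2 + q * x * y + r * y ^ 2)) (by fun_prop) a b hab
    (fun x y => by
      have h1 := h x y
      rw [hf] at h1
      linear_combination h1)
  intro x y
  have := this x y
  linarith

lemma quad_caseB (G : ℝ → ℝ → ℝ) (hG : Continuous fun p : ℝ × ℝ => G p.1 p.2) (a b c : ℝ)
    (u w : ℝ) (huw : u ≠ 0 ∨ w ≠ 0) (h0 : a * u ^ 2 + b * u * w + c * w ^ 2 = 0)
    (hne : ∃ x y, a * x ^ 2 + b * x * y + c * y ^ 2 ≠ 0) (c1 c2 c3 c4 c5 : ℝ)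
    (h : ∀ x y, G x y * (a * x ^ 2 + b * x * y + c * y ^ 2)
      = c1 * x ^ 4 + c2 * x ^ 3 * y + c3 * x ^ 2 * y ^ 2 + c4 * x * y ^ 3 + c5 * y ^ 4) :
    ∃ a b c, ∀ x y, G x y = a * x ^ 2 + b * x * y + c * y ^ 2 := by
  obtain ⟨p, r, hf⟩ := quad_factor a b c u w huw h0
  obtain ⟨p', q', r', s', hf'⟩ := quartic_factor c1 c2 c3 c4 c5 u w huw (by rw [← h, h0, mul_zero])
  have hpr : p ≠ 0 ∨ r ≠ 0 := by
    by_contra hcon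
    push Not at hcon
    obtain ⟨x, y, hxy⟩ := hne
    apply hxy
    rw [hf, hcon.1, hcon.2]; ring
  refine quad_caseA G hG p r hpr p' q' r' s' ?_
  have := lin_cancel (fun x y => G x y * (p * x + r * y) -
    (p' * x ^ 3 + q' * x ^ 2 * y + r' * x * y ^ 2 + s' * y ^ 3)) (by fun_prop) w (-u)
    (by simpa using huw.symm) (fun x y => by
      have h1 := h x y
      rw [hf, hf'] at h1
      linear_combination h1)
  intro x y
  have := this x y
  linarith

lemma poly5_zero (c0 c1 c2 c3 c4 c5 : ℝ)
    (h : ∀ x : ℝ, c0 + c1 * x + c2 * x ^ 2 + c3 * x ^ 3 + c4 * x ^ 4 + c5 * x ^ 5 = 0) :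
    c0 = 0 ∧ c1 = 0 ∧ c2 = 0 ∧ c3 = 0 ∧ c4 = 0 ∧ c5 = 0 := by
  have h0 := h 0
  have h1 := h 1
  have h2 := h (-1)
  have h3 := h 2
  have h4 := h (-2)
  have h5 := h 3
  norm_num at h0 h1 h2 h3 h4 h5
  refine ⟨?_, ?_, ?_, ?_, ?_, ?_⟩ <;> linarith

lemma quad_caseC (G : ℝ → ℝ → ℝ) (hG : Continuous fun p : ℝ × ℝ => G p.1 p.2)
    (hh : ∀ t x y, G (t * x) (t * y) = t ^ 2 * G x y) (a b c : ℝ)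
    (hdef : ∀ u w, (u ≠ 0 ∨ w ≠ 0) → a * u ^ 2 + b * u * w + c * w ^ 2 ≠ 0)
    (c1 c2 c3 c4 c5 : ℝ)
    (h : ∀ x y, G x y * (a * x ^ 2 + b * x * y + c * y ^ 2)
      = c1 * x ^ 4 + c2 * x ^ 3 * y + c3 * x ^ 2 * y ^ 2 + c4 * x * y ^ 3 + c5 * y ^ 4)
    (d1 d2 d3 d4 : ℝ)
    (hd : ∀ x, HasDerivAt (fun s => G s 1)
      ((d1 * x ^ 3 + d2 * x ^ 2 + d3 * x + d4) / (a * x ^ 2 + b * x + c)) x) :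
    ∃ a b c, ∀ x y, G x y = a * x ^ 2 + b * x * y + c * y ^ 2 := by
  have ha : a ≠ 0 := by simpa using hdef 1 0 (by simp)
  have hnz : ∀ x : ℝ, a * x ^ 2 + b * x + c ≠ 0 := fun x => by simpa using hdef x 1 (by simp)
  have hdisc : b ^ 2 - 4 * a * c < 0 := by
    by_contra hcon
    push Not at hcon
    apply hnz ((-b + Real.sqrt (b ^ 2 - 4 * a * c)) / (2 * a))
    have := Real.sq_sqrt hcon
    generalize Real.sqrt (b ^ 2 - 4 * a * c) = D at this
    field_simp
    linear_combination this
  -- polynomial identity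
  have hid : ∀ x : ℝ, (a * x ^ 2 + b * x + c) * (4 * c1 * x ^ 3 + 3 * c2 * x ^ 2 + 2 * c3 * x + c4)
      = (a * x ^ 2 + b * x + c) * (d1 * x ^ 3 + d2 * x ^ 2 + d3 * x + d4)
        + (c1 * x ^ 4 + c2 * x ^ 3 + c3 * x ^ 2 + c4 * x + c5) * (2 * a * x + b) := by
    intro x
    have hq : HasDerivAt (fun s : ℝ => a * s ^ 2 + b * s + c) (2 * a * x + b) x := by
      have := (((hasDerivAt_pow 2 x).const_mul a).add ((hasDerivAt_id x).const_mul b)).add_const c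
      refine HasDerivAt.congr_deriv (f := fun s : ℝ => a * s ^ 2 + b * s + c) this ?_
      simp; ring
    have hp : HasDerivAt (fun s : ℝ => c1 * s ^ 4 + c2 * s ^ 3 + c3 * s ^ 2 + c4 * s + c5)
        (4 * c1 * x ^ 3 + 3 * c2 * x ^ 2 + 2 * c3 * x + c4) x := by
      have := (((((hasDerivAt_pow 4 x).const_mul c1).add ((hasDerivAt_pow 3 x).const_mul c2)).add
        ((hasDerivAt_pow 2 x).const_mul c3)).add ((hasDerivAt_id x).const_mul c4)).add_const c5
      refine HasDerivAt.congr_deriv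
        (f := fun s : ℝ => c1 * s ^ 4 + c2 * s ^ 3 + c3 * s ^ 2 + c4 * s + c5) this ?_
      simp; ring
    have hm := (hd x).mul hq
    have hfe : ((fun s => G s 1) * fun s : ℝ => a * s ^ 2 + b * s + c)
        = fun s : ℝ => c1 * s ^ 4 + c2 * s ^ 3 + c3 * s ^ 2 + c4 * s + c5 := by
      funext s
      have := h s 1
      simp at this
      simpa using this
    rw [hfe] at hm
    have h1 := hp.unique hm
    have h2 := h x 1
    simp at h2
    have h3 := hnz x
    rw [h1, ← h2, div_mul_cancel₀ _ h3]
    ring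
  set q2 := c1 / a with hq2
  set q1 := (c2 - b * q2) / a with hq1
  set q0 := (c3 - c * q2 - b * q1) / a with hq0
  set r := c4 - c * q1 - b * q0 with hr
  set s := c5 - c * q0 with hs
  have e1 : c1 = a * q2 := by rw [hq2]; field_simp
  have e2 : c2 = a * q1 + b * q2 := by rw [hq1]; field_simp; ring
  have e3 : c3 = a * q0 + b * q1 + c * q2 := by rw [hq0]; field_simp; ring
  have e4 : c4 = b * q0 + c * q1 + r := by rw [hr]; ring
  have e5 : c5 = c * q0 + s := by rw [hs]; ring
  clear_value q2 q1 q0 r s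
  subst e1 e2 e3 e4 e5
  -- quotient
  obtain ⟨z0, z1, z2, z3, z4, z5⟩ := poly5_zero
    (c * (c * q1 + r - d4) - s * b)
    (c * (2 * c * q2 + b * q1 - d3) + b * (c * q1 + r - d4) - r * b - 2 * a * s)
    (c * (2 * b * q2 + a * q1 - d2) + b * (2 * c * q2 + b * q1 - d3) + a * (c * q1 + r - d4)
      - 2 * a * r)
    (c * (2 * a * q2 - d1) + b * (2 * b * q2 + a * q1 - d2) + a * (2 * c * q2 + b * q1 - d3))
    (b * (2 * a * q2 - d1) + a * (2 * b * q2 + a * q1 - d2))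
    (a * (2 * a * q2 - d1)) (fun x => by linear_combination hid x)
  have m3 : 2 * a * q2 - d1 = 0 := (mul_eq_zero.mp z5).resolve_left ha
  rw [m3] at z4 z3
  have m2 : 2 * b * q2 + a * q1 - d2 = 0 := by
    have : a * (2 * b * q2 + a * q1 - d2) = 0 := by linarith
    exact (mul_eq_zero.mp this).resolve_left ha
  rw [m2] at z3 z2
  have m1 : 2 * c * q2 + b * q1 - d3 = 0 := by
    have : a * (2 * c * q2 + b * q1 - d3) = 0 := by linarith
    exact (mul_eq_zero.mp this).resolve_left ha
  rw [m1] at z2 z1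
  have m0 : c * q1 + r - d4 = 2 * r := by
    have : a * (c * q1 + r - d4 - 2 * r) = 0 := by linarith
    have := (mul_eq_zero.mp this).resolve_left ha
    linarith
  rw [m0] at z1 z0
  have hr0 : r = 0 := by
    have : r * (b ^ 2 - 4 * a * c) = 0 := by linear_combination b * z1 - 2 * a * z0
    exact (mul_eq_zero.mp this).resolve_right hdisc.ne
  have hs0 : s = 0 := by
    subst hr0
    have : a * s = 0 := by linarith
    exact (mul_eq_zero.mp this).resolve_left ha
  subst hr0 hs0
  refine ⟨q2, q1, q0, ?_⟩
  have hG1 : ∀ x, G x 1 = q2 * x ^ 2 + q1 * x + q0 := by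
    intro x
    have h2 := h x 1
    have h3 := hnz x
    apply mul_right_cancel₀ h3
    simp at h2
    rw [h2]; ring
  have := lin_cancel (fun x y => G x y - (q2 * x ^ 2 + q1 * x * y + q0 * y ^ 2)) (by fun_prop) 0 1
    (by simp) (fun x y => by
      by_cases hy : y = 0
      · simp [hy]
      · have h1 := hh y (x / y) 1
        rw [mul_div_cancel₀ _ hy, mul_one, hG1] at h1
        rw [h1]; field_simp; ring)
  intro x y
  have := this x y
  linarith

lemma poly_dense (p : Polynomial ℝ) (hp : p.eval 0 ≠ 0) (E : ℝ → ℝ) (hE : Continuous E)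
    (h : ∀ s, p.eval s ≠ 0 → E s = 0) : E 1 = 0 := by
  have hp0 : p ≠ 0 := by rintro rfl; simp at hp
  have hfin : (p.rootSet ℝ).Finite := p.rootSet_finite ℝ
  have hd : Dense (p.rootSet ℝ)ᶜ := hfin.countable.dense_compl ℝ
  have := Continuous.ext_on hd hE continuous_const (g := fun _ => (0 : ℝ)) (fun s hs => by
    apply h
    intro h0
    apply hs
    rw [Polynomial.mem_rootSet]
    exact ⟨hp0, by simpa using h0⟩)
  exact congrFun this 1

lemma propA (F : ℝ → ℝ → ℝ → ℝ) (hc : Continuous fun p : ℝ × ℝ × ℝ => F p.1 p.2.1 p.2.2)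
    (hhom : ∀ s x y z, 0 ≤ s → F (s * x) (s * y) (s * z) = s * F x y z)
    (hpos : ∀ x y z, (x ≠ 0 ∨ y ≠ 0 ∨ z ≠ 0) → 0 < F x y z)
    (hsup : ∀ x y z, z ≤ F x y z) (h001 : F 0 0 1 = 1)
    (N1 N2 N3 g : ℝ → ℝ → ℝ → ℝ)
    (a1 a2 a3 a4 a5 a6 a7 a8 a9 b1 b2 b3 b4 b5 b6 b7 b8 b9 c1 c2 c3 c4 c5 c6 c7 c8 c9 : ℝ)
    (hN1 : ∀ x y z, N1 x y z = (a1 * x + a2 * y) * z ^ 2 + (a3 * x ^ 2 + a4 * x * y + a5 * y ^ 2) * z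
      + (a6 * x ^ 3 + a7 * x ^ 2 * y + a8 * x * y ^ 2 + a9 * y ^ 3))
    (hN2 : ∀ x y z, N2 x y z = (b1 * x + b2 * y) * z ^ 2 + (b3 * x ^ 2 + b4 * x * y + b5 * y ^ 2) * z
      + (b6 * x ^ 3 + b7 * x ^ 2 * y + b8 * x * y ^ 2 + b9 * y ^ 3))
    (hN3 : ∀ x y z, N3 x y z = (c1 * x + c2 * y) * z ^ 2 + (c3 * x ^ 2 + c4 * x * y + c5 * y ^ 2) * z
      + (c6 * x ^ 3 + c7 * x ^ 2 * y + c8 * x * y ^ 2 + c9 * y ^ 3))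
    (hg : ∀ x y z, g x y z = x * N1 x y z + y * N2 x y z + z * N3 x y z)
    (hb : ∀ a b c, ∃ C, ∀ x y z, |a * N1 x y z + b * N2 x y z + c * N3 x y z| * F x y z
      ≤ C * |g x y z|)
    (hder : ∀ x y z a b c, g x y z ≠ 0 → HasDerivAt (fun s => F (x + s * a) (y + s * b) (z + s * c))
      (F x y z * (a * N1 x y z + b * N2 x y z + c * N3 x y z) / g x y z) 0)
    (hne : ∃ x y z, g x y z ≠ 0) :
    ∃ a b c, ∀ x y z, F x y z ^ 2 = z ^ 2 + (a * x ^ 2 + b * x * y + c * y ^ 2) := by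
  obtain ⟨x0, y0, z0, hP⟩ := hne
  -- sections
  have hsec : ∀ x y z, g x y z ≠ 0 → ∀ t w, F (t * x) (t * y) w ^ 2 = w ^ 2 + t ^ 2 * F x y 0 ^ 2 := by
    intro x y z hxyz
    have hxy : x ≠ 0 ∨ y ≠ 0 := by
      by_contra hcon
      push Not at hcon
      apply hxyz
      rw [hg, hN3, hcon.1, hcon.2]; ring
    obtain ⟨C1, hC1⟩ := hb 0 0 1
    obtain ⟨C2, hC2⟩ := hb x y 0
    obtain ⟨A, B, C, hABC⟩ := section_quad (fun z t => F (t * x) (t * y) z)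
      (hc.comp (f := fun p : ℝ × ℝ => (p.2 * x, p.2 * y, p.1)) (by fun_prop))
      (fun s z t hs => by simp only [mul_assoc]; rw [hhom s (t * x) (t * y) z hs])
      (fun z t hzt => by
        apply hpos
        rcases hzt with h | h
        · right; right; exact h
        · rcases hxy with h' | h'
          · left; exact mul_ne_zero h h'
          · right; left; exact mul_ne_zero h h')
      (c1 * x + c2 * y) (c3 * x ^ 2 + c4 * x * y + c5 * y ^ 2)
      (c6 * x ^ 3 + c7 * x ^ 2 * y + c8 * x * y ^ 2 + c9 * y ^ 3)
      (x * (a1 * x + a2 * y) + y * (b1 * x + b2 * y))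
      (x * (a3 * x ^ 2 + a4 * x * y + a5 * y ^ 2) + y * (b3 * x ^ 2 + b4 * x * y + b5 * y ^ 2))
      (x * (a6 * x ^ 3 + a7 * x ^ 2 * y + a8 * x * y ^ 2 + a9 * y ^ 3)
        + y * (b6 * x ^ 3 + b7 * x ^ 2 * y + b8 * x * y ^ 2 + b9 * y ^ 3))
      (max C1 C2) _ _ (fun z t => g (t * x) (t * y) z) (fun z t => rfl) (fun z t => rfl)
      (fun z t => by simp only [hg, hN1, hN2, hN3]; ring)
      (fun z t => by
        have h1 := hC1 (t * x) (t * y) z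
        have h2 : C1 * |g (t * x) (t * y) z| ≤ max C1 C2 * |g (t * x) (t * y) z| :=
          mul_le_mul_of_nonneg_right (le_max_left _ _) (abs_nonneg _)
        refine le_trans (le_of_eq ?_) (h1.trans h2)
        congr 2
        rw [hN3]; ring)
      (fun z t => by
        have h1 := hC2 (t * x) (t * y) z
        have h2 : C2 * |g (t * x) (t * y) z| ≤ max C1 C2 * |g (t * x) (t * y) z| :=
          mul_le_mul_of_nonneg_right (le_max_right _ _) (abs_nonneg _)
        refine le_trans (le_of_eq ?_) (h1.trans h2)
        congr 2
        rw [hN1, hN2]; ring)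
      ⟨z, 1, by simpa using hxyz⟩
      (fun z t a b hq => by
        have h1 := hder (t * x) (t * y) z (b * x) (b * y) a hq
        have h2 : (fun s => F ((t + s * b) * x) ((t + s * b) * y) (z + s * a))
          = fun s => F (t * x + s * (b * x)) (t * y + s * (b * y)) (z + s * a) := by
          funext s; congr 1 <;> ring
        rw [h2]
        refine h1.congr_deriv ?_
        congr 2
        rw [hN1, hN2, hN3]; ring)
    have hA : A = 1 := by
      have := hABC 1 0
      simp [h001] at this
      exact this.symm
    have hCC : C = F x y 0 ^ 2 := by
      have := hABC 0 1
      simp at this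
      exact this.symm
    have hB1 : ∀ w, 0 < w → 0 ≤ B * w + C := by
      intro w hw
      have h1 := hABC w 1
      have h2 := hsup (1 * x) (1 * y) w
      rw [hA] at h1
      nlinarith
    have hB2 : ∀ w, 0 < w → 0 ≤ -B * w + C := by
      intro w hw
      have h1 := hABC w (-1)
      have h2 := hsup (-1 * x) (-1 * y) w
      rw [hA] at h1
      nlinarith
    have hC0 : 0 ≤ C := by rw [hCC]; positivity
    have hB : B = 0 := by
      by_contra hB
      rcases lt_or_gt_of_ne hB with h | h
      · have := hB1 ((C + 1) / (-B)) (by apply div_pos <;> linarith)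
        have e : B * ((C + 1) / (-B)) = -(C + 1) := by field_simp
        linarith
      · have := hB2 ((C + 1) / B) (by apply div_pos <;> linarith)
        have e : -B * ((C + 1) / B) = -(C + 1) := by field_simp
        linarith
    intro t w
    rw [hABC w t, hA, hB, hCC]; ring
  -- density
  have hdense : ∀ E : ℝ → ℝ → ℝ → ℝ, (Continuous fun p : ℝ × ℝ × ℝ => E p.1 p.2.1 p.2.2) →
      (∀ x y z, g x y z ≠ 0 → E x y z = 0) → ∀ x y z, E x y z = 0 := by
    intro E hE h x y z
    let px : Polynomial ℝ := Polynomial.C x0 + Polynomial.X * Polynomial.C (x - x0)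
    let py : Polynomial ℝ := Polynomial.C y0 + Polynomial.X * Polynomial.C (y - y0)
    let pz : Polynomial ℝ := Polynomial.C z0 + Polynomial.X * Polynomial.C (z - z0)
    let cub : ℝ → ℝ → ℝ → ℝ → ℝ → ℝ → ℝ → ℝ → ℝ → Polynomial ℝ :=
      fun a1 a2 a3 a4 a5 a6 a7 a8 a9 =>
      (Polynomial.C a1 * px + Polynomial.C a2 * py) * pz ^ 2
      + (Polynomial.C a3 * px ^ 2 + Polynomial.C a4 * px * py + Polynomial.C a5 * py ^ 2) * pz
      + (Polynomial.C a6 * px ^ 3 + Polynomial.C a7 * px ^ 2 * py + Polynomial.C a8 * px * py ^ 2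
        + Polynomial.C a9 * py ^ 3)
    let P : Polynomial ℝ := px * cub a1 a2 a3 a4 a5 a6 a7 a8 a9 + py * cub b1 b2 b3 b4 b5 b6 b7 b8 b9
      + pz * cub c1 c2 c3 c4 c5 c6 c7 c8 c9
    have hPe : ∀ s, P.eval s = g (x0 + s * (x - x0)) (y0 + s * (y - y0)) (z0 + s * (z - z0)) := by
      intro s
      simp only [P, cub, px, py, pz, Polynomial.eval_add, Polynomial.eval_mul, Polynomial.eval_pow,
        Polynomial.eval_C, Polynomial.eval_X, hg, hN1, hN2, hN3]
    have := poly_dense P (by rw [hPe]; simpa using hP)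
      (fun s => E (x0 + s * (x - x0)) (y0 + s * (y - y0)) (z0 + s * (z - z0)))
      (hE.comp (f := fun s : ℝ => (x0 + s * (x - x0), y0 + s * (y - y0), z0 + s * (z - z0)))
        (by fun_prop))
      (fun s hs => h _ _ _ (by rwa [← hPe]))
    simpa using this
  have hGc : Continuous fun p : ℝ × ℝ => F p.1 p.2 0 ^ 2 :=
    (hc.comp (f := fun p : ℝ × ℝ => (p.1, p.2, (0 : ℝ))) (by fun_prop)).pow 2
  have hGc3 : Continuous fun p : ℝ × ℝ × ℝ => F p.1 p.2.1 0 ^ 2 :=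
    (hc.comp (f := fun p : ℝ × ℝ × ℝ => (p.1, p.2.1, (0 : ℝ))) (by fun_prop)).pow 2
  have hF2 : ∀ x y z, F x y z ^ 2 = z ^ 2 + F x y 0 ^ 2 := by
    have := hdense (fun x y z => F x y z ^ 2 - (z ^ 2 + F x y 0 ^ 2)) (by fun_prop)
      (fun x y z h => by
        have := hsec x y z h 1 z
        simp at this
        linarith)
    intro x y z
    linarith [this x y z]
  have hGh : ∀ t x y, F (t * x) (t * y) 0 ^ 2 = t ^ 2 * F x y 0 ^ 2 := by
    intro t x y
    have hcc : Continuous fun p : ℝ × ℝ × ℝ => F (t * p.1) (t * p.2.1) 0 ^ 2 :=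
      (hc.comp (f := fun p : ℝ × ℝ × ℝ => (t * p.1, t * p.2.1, (0 : ℝ))) (by fun_prop)).pow 2
    have := hdense (fun x y z => F (t * x) (t * y) 0 ^ 2 - t ^ 2 * F x y 0 ^ 2) (by fun_prop)
      (fun x y z h => by
        have := hsec x y z h t 0
        simp at this
        linarith)
    linarith [this x y 0]
  have hder2 : ∀ x y z a b c, g x y z ≠ 0 →
      HasDerivAt (fun s => F (x + s * a) (y + s * b) (z + s * c) ^ 2)
      (2 * F x y z ^ 2 * (a * N1 x y z + b * N2 x y z + c * N3 x y z) / g x y z) 0 := by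
    intro x y z a b c h
    have h1 := (hder x y z a b c h).pow 2
    refine HasDerivAt.congr_deriv
      (f := fun s => F (x + s * a) (y + s * b) (z + s * c) ^ 2) h1 ?_
    simp
    ring
  have hN1c : Continuous fun p : ℝ × ℝ × ℝ => N1 p.1 p.2.1 p.2.2 := by simp only [hN1]; fun_prop
  have hN2c : Continuous fun p : ℝ × ℝ × ℝ => N2 p.1 p.2.1 p.2.2 := by simp only [hN2]; fun_prop
  have hN3c : Continuous fun p : ℝ × ℝ × ℝ => N3 p.1 p.2.1 p.2.2 := by simp only [hN3]; fun_prop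
  have hgc : Continuous fun p : ℝ × ℝ × ℝ => g p.1 p.2.1 p.2.2 := by simp only [hg]; fun_prop
  have hzid : ∀ x y z, (z ^ 2 + F x y 0 ^ 2) * N3 x y z = z * g x y z := by
    have := hdense (fun x y z => (z ^ 2 + F x y 0 ^ 2) * N3 x y z - z * g x y z) (by fun_prop)
      (fun x y z h => by
        have h1 := hder2 x y z 0 0 1 h
        have h2 : (fun s => F (x + s * 0) (y + s * 0) (z + s * 1) ^ 2)
            = fun s => (z + s) ^ 2 + F x y 0 ^ 2 := by
          funext s; rw [hF2]; simp
        rw [h2] at h1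
        have h3 : HasDerivAt (fun s : ℝ => (z + s) ^ 2 + F x y 0 ^ 2) (2 * z) 0 := by
          have := (((hasDerivAt_id (0 : ℝ)).const_add z).pow 2).add_const (F x y 0 ^ 2)
          refine HasDerivAt.congr_deriv (f := fun s : ℝ => (z + s) ^ 2 + F x y 0 ^ 2) this ?_
          simp
        have h4 := h3.unique h1
        rw [eq_div_iff h, hF2 x y z] at h4
        linarith)
    intro x y z
    linarith [this x y z]
  have hA3 : ∀ x y, c6 * x ^ 3 + c7 * x ^ 2 * y + c8 * x * y ^ 2 + c9 * y ^ 3 = 0 := by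
    intro x y
    by_cases hxy : x = 0 ∧ y = 0
    · rw [hxy.1, hxy.2]; ring
    · have h1 := hzid x y 0
      have h2 : 0 < F x y 0 := hpos x y 0 (by tauto)
      rw [hN3] at h1
      simp at h1
      exact h1.resolve_left h2.ne'
  have hgz : ∀ x y z, z ≠ 0 → (z ^ 2 + F x y 0 ^ 2) * ((c1 * x + c2 * y) * z
      + (c3 * x ^ 2 + c4 * x * y + c5 * y ^ 2)) = g x y z := by
    intro x y z hz
    have h1 := hzid x y z
    rw [hN3, hA3] at h1
    apply mul_left_cancel₀ hz
    rw [← h1]; ring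
  have hGA : ∀ x y, F x y 0 ^ 2 * (c1 * x + c2 * y) = a3 * x ^ 3 + (a4 + b3) * x ^ 2 * y
      + (a5 + b4) * x * y ^ 2 + b5 * y ^ 3 := by
    intro x y
    have e0 := hA3 x y
    have e1 := hgz x y 1 (by norm_num)
    have e2 := hgz x y (-1) (by norm_num)
    have e3 := hgz x y 2 (by norm_num)
    simp only [hg, hN1, hN2, hN3, e0] at e1 e2 e3
    linear_combination (e1 - e2) / 2
  have hGB : ∀ x y, F x y 0 ^ 2 * (c3 * x ^ 2 + c4 * x * y + c5 * y ^ 2) = a6 * x ^ 4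
      + (a7 + b6) * x ^ 3 * y + (a8 + b7) * x ^ 2 * y ^ 2 + (a9 + b8) * x * y ^ 3 + b9 * y ^ 4 := by
    intro x y
    have e0 := hA3 x y
    have e1 := hgz x y 1 (by norm_num)
    have e2 := hgz x y (-1) (by norm_num)
    have e3 := hgz x y 2 (by norm_num)
    have e4 := hGA x y
    simp only [hg, hN1, hN2, hN3, e0] at e1 e2 e3
    linear_combination (4 / 3) * (e1 + e2) / 2 - e3 / 3 + (2 / 3) * e4
  have hfin : ∃ a b c, ∀ x y, F x y 0 ^ 2 = a * x ^ 2 + b * x * y + c * y ^ 2 := by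
    by_cases hA : c1 ≠ 0 ∨ c2 ≠ 0
    · exact quad_caseA (fun x y => F x y 0 ^ 2) hGc c1 c2 hA _ _ _ _ hGA
    push Not at hA
    have hBne : ∃ x y, c3 * x ^ 2 + c4 * x * y + c5 * y ^ 2 ≠ 0 := by
      by_contra hcon
      push Not at hcon
      apply hP
      by_cases hz : z0 = 0
      · have h1 := hGB x0 y0
        rw [hcon] at h1
        rw [hz, hg, hN1, hN2, hN3]
        linear_combination -h1
      · rw [← hgz _ _ _ hz, hcon, hA.1, hA.2]; ring
    by_cases hroot : ∃ u w, (u ≠ 0 ∨ w ≠ 0) ∧ c3 * u ^ 2 + c4 * u * w + c5 * w ^ 2 = 0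
    · obtain ⟨u, w, huw, h0⟩ := hroot
      exact quad_caseB (fun x y => F x y 0 ^ 2) hGc c3 c4 c5 u w huw h0 hBne _ _ _ _ _ hGB
    · push Not at hroot
      refine quad_caseC (fun x y => F x y 0 ^ 2) hGc hGh c3 c4 c5 hroot _ _ _ _ _ hGB
        (2 * a6) (2 * a7) (2 * a8) (2 * a9) ?_
      intro x
      have hne : c3 * x ^ 2 + c4 * x + c5 ≠ 0 := by simpa using hroot x 1 (by simp)
      have hF0 : F x 1 0 ≠ 0 := (hpos x 1 0 (by simp)).ne'
      have hgx : g x 1 0 = F x 1 0 ^ 2 * (c3 * x ^ 2 + c4 * x + c5) := by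
        have := hGB x 1
        rw [hg, hN1, hN2, hN3]
        linear_combination -this
      have h1 := hder2 x 1 0 1 0 0 (by rw [hgx]; exact mul_ne_zero (pow_ne_zero _ hF0) hne)
      have h2 := HasDerivAt.comp_sub_const (x := x) (a := x)
        (f := fun s => F (x + s * 1) (1 + s * 0) (0 + s * 0) ^ 2) (by rw [sub_self]; exact h1)
      have h3 : (fun s => F (x + (s - x) * 1) (1 + (s - x) * 0) (0 + (s - x) * 0) ^ 2)
          = fun s => F s 1 0 ^ 2 := by
        funext s; simp
      rw [h3] at h2
      refine h2.congr_deriv ?_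
      rw [hgx, hN1]
      field_simp
      ring
  obtain ⟨a, b, c, h⟩ := hfin
  exact ⟨a, b, c, fun x y z => by rw [hF2, h]⟩

/-- One-sided flatness of `F` at `x` in the direction `v`. -/
def FlatDir {X : Type*} [AddCommGroup X] [Module ℝ X] (F : X → ℝ) (x v : X) : Prop :=
  ∀ ε : ℝ, 0 < ε → ∃ t : ℝ, 0 < t ∧ F (x + t • v) ≤ F x + ε * t

/-- Two-sided flatness. -/
def FlatD {X : Type*} [AddCommGroup X] [Module ℝ X] (F : X → ℝ) (x v : X) : Prop :=
  FlatDir F x v ∧ FlatDir F x (-v)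

lemma flat_mono {X : Type*} [AddCommGroup X] [Module ℝ X] (F : X → ℝ)
    (hsub : ∀ x y, F (x + y) ≤ F x + F y) (hhom : ∀ (s : ℝ) x, 0 ≤ s → F (s • x) = s * F x)
    (x v : X) (h : FlatDir F x v) (ε : ℝ) (hε : 0 < ε) :
    ∃ t : ℝ, 0 < t ∧ ∀ s, 0 ≤ s → s ≤ t → F (x + s • v) ≤ F x + ε * s := by
  obtain ⟨t, ht, h1⟩ := h ε hε
  refine ⟨t, ht, fun s hs hst => ?_⟩
  have e : x + s • v = (1 - s / t) • x + (s / t) • (x + t • v) := by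
    rw [smul_add, smul_smul, div_mul_cancel₀ _ ht.ne', sub_smul, one_smul]; abel
  have hst' : s / t ≤ 1 := (div_le_one ht).2 hst
  have hs' : 0 ≤ s / t := by positivity
  have h2 := hsub ((1 - s / t) • x) ((s / t) • (x + t • v))
  rw [hhom _ _ (by linarith), hhom _ _ hs', ← e] at h2
  have h3 := mul_le_mul_of_nonneg_left h1 hs'
  have h4 : s / t * (ε * t) = ε * s := by field_simp
  nlinarith

lemma flat_add {X : Type*} [AddCommGroup X] [Module ℝ X] (F : X → ℝ)
    (hsub : ∀ x y, F (x + y) ≤ F x + F y) (hhom : ∀ (s : ℝ) x, 0 ≤ s → F (s • x) = s * F x)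
    (x v w : X) (hv : FlatDir F x v) (hw : FlatDir F x w) : FlatDir F x (v + w) := by
  intro ε hε
  obtain ⟨t1, ht1, h1⟩ := flat_mono F hsub hhom x v hv (ε / 2) (by linarith)
  obtain ⟨t2, ht2, h2⟩ := flat_mono F hsub hhom x w hw (ε / 2) (by linarith)
  have hm : 0 < min t1 t2 := lt_min ht1 ht2
  have k1 := h1 (min t1 t2) hm.le (min_le_left _ _)
  have k2 := h2 (min t1 t2) hm.le (min_le_right _ _)
  generalize min t1 t2 = t at *
  refine ⟨t / 2, by linarith, ?_⟩
  have e : x + (t / 2) • (v + w) = (1 / 2 : ℝ) • (x + t • v) + (1 / 2 : ℝ) • (x + t • w) := by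
    module
  rw [e]
  have h3 := hsub ((1 / 2 : ℝ) • (x + t • v)) ((1 / 2 : ℝ) • (x + t • w))
  rw [hhom _ _ (by norm_num), hhom _ _ (by norm_num)] at h3
  linarith

lemma flat_smul {X : Type*} [AddCommGroup X] [Module ℝ X] (F : X → ℝ)
    (x v : X) (c : ℝ) (hc : 0 ≤ c) (hv : FlatDir F x v) : FlatDir F x (c • v) := by
  intro ε hε
  rcases hc.eq_or_lt with rfl | hc
  · exact ⟨1, one_pos, by simp; exact hε.le⟩
  obtain ⟨t, ht, h1⟩ := hv (ε / c) (by positivity)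
  refine ⟨t / c, by positivity, ?_⟩
  rw [smul_smul, div_mul_cancel₀ _ hc.ne']
  refine h1.trans (le_of_eq ?_)
  field_simp

lemma flatD_smul {X : Type*} [AddCommGroup X] [Module ℝ X] (F : X → ℝ)
    (x v : X) (c : ℝ) (hv : FlatD F x v) : FlatD F x (c • v) := by
  rcases le_total 0 c with hc | hc
  · refine ⟨flat_smul F x v c hc hv.1, ?_⟩
    rw [← smul_neg]
    exact flat_smul F x _ c hc hv.2
  · constructor
    · have := flat_smul F x _ (-c) (by linarith) hv.2
      simpa using this
    · have := flat_smul F x _ (-c) (by linarith) hv.1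
      simpa using this

lemma flatD_comb {X : Type*} [AddCommGroup X] [Module ℝ X] (F : X → ℝ)
    (hsub : ∀ x y, F (x + y) ≤ F x + F y) (hhom : ∀ (s : ℝ) x, 0 ≤ s → F (s • x) = s * F x)
    (x v w : X) (a b : ℝ) (hv : FlatD F x v) (hw : FlatD F x w) : FlatD F x (a • v + b • w) := by
  have h1 := flatD_smul F x v a hv
  have h2 := flatD_smul F x w b hw
  refine ⟨flat_add F hsub hhom x _ _ h1.1 h2.1, ?_⟩
  rw [neg_add]
  exact flat_add F hsub hhom x _ _ h1.2 h2.2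

lemma not_flat_self {X : Type*} [AddCommGroup X] [Module ℝ X] (F : X → ℝ)
    (hhom : ∀ (s : ℝ) x, 0 ≤ s → F (s • x) = s * F x) (x : X) (hx : 0 < F x) :
    ¬ FlatDir F x x := by
  intro h
  obtain ⟨t, ht, h1⟩ := h (F x / 2) (by linarith)
  have e : x + t • x = (1 + t) • x := by module
  rw [e, hhom _ _ (by linarith)] at h1
  nlinarith [mul_pos ht hx]

lemma flat_scale {X : Type*} [AddCommGroup X] [Module ℝ X] (F : X → ℝ)
    (hhom : ∀ (s : ℝ) x, 0 ≤ s → F (s • x) = s * F x) (x v : X) (c : ℝ) (hc : 0 < c)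
    (h : FlatDir F x v) : FlatDir F (c • x) v := by
  intro ε hε
  obtain ⟨t, ht, h1⟩ := h ε hε
  refine ⟨c * t, by positivity, ?_⟩
  rw [mul_smul, ← smul_add, hhom _ _ hc.le, hhom _ _ hc.le]
  nlinarith

lemma flatD_deriv {X : Type*} [AddCommGroup X] [Module ℝ X] (F : X → ℝ)
    (hsub : ∀ x y, F (x + y) ≤ F x + F y) (hhom : ∀ (s : ℝ) x, 0 ≤ s → F (s • x) = s * F x)
    (x v : X) (hv : FlatD F x v) : HasDerivAt (fun t : ℝ => F (x + t • v)) 0 0 := by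
  rw [hasDerivAt_iff_isLittleO_nhds_zero, Asymptotics.isLittleO_iff]
  intro ε hε
  obtain ⟨t1, ht1, h1⟩ := flat_mono F hsub hhom x v hv.1 ε hε
  obtain ⟨t2, ht2, h2⟩ := flat_mono F hsub hhom x (-v) hv.2 ε hε
  have hm : 0 < min t1 t2 := lt_min ht1 ht2
  have hup : ∀ t : ℝ, |t| ≤ min t1 t2 → F (x + t • v) ≤ F x + ε * |t| := by
    intro t ht
    rcases le_total 0 t with h | h
    · rw [abs_of_nonneg h] at *
      exact h1 t h (ht.trans (min_le_left _ _))
    · rw [abs_of_nonpos h] at *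
      have := h2 (-t) (by linarith) (ht.trans (min_le_right _ _))
      simpa using this
  filter_upwards [Metric.ball_mem_nhds (0 : ℝ) hm] with t ht
  have ht' : |t| ≤ min t1 t2 := by simpa using (le_of_lt (by simpa using ht : |t| < min t1 t2))
  have k1 := hup t ht'
  have k2 := hup (-t) (by rwa [abs_neg])
  rw [abs_neg] at k2
  have e : x = (1 / 2 : ℝ) • (x + t • v) + (1 / 2 : ℝ) • (x + (-t) • v) := by module
  have h3 := hsub ((1 / 2 : ℝ) • (x + t • v)) ((1 / 2 : ℝ) • (x + (-t) • v))
  rw [hhom _ _ (by norm_num), hhom _ _ (by norm_num), ← e] at h3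
  simp only [zero_add, zero_smul, add_zero, smul_zero, sub_zero, Real.norm_eq_abs]
  rw [abs_le]
  constructor <;> linarith

lemma flatD_deriv_add {X : Type*} [AddCommGroup X] [Module ℝ X] (F : X → ℝ)
    (hsub : ∀ x y, F (x + y) ≤ F x + F y) (hhom : ∀ (s : ℝ) x, 0 ≤ s → F (s • x) = s * F x)
    (x v : X) (a : ℝ) (hv : FlatD F x v) :
    HasDerivAt (fun t : ℝ => F (x + t • (v + a • x))) (a * F x) 0 := by
  have h0 := flatD_deriv F hsub hhom x v hv
  have hd : HasDerivAt (fun t : ℝ => 1 + t * a) a 0 := by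
    have := ((hasDerivAt_id (0 : ℝ)).mul_const a).const_add 1
    refine HasDerivAt.congr_deriv (f := fun t : ℝ => 1 + t * a) this ?_
    simp
  have hq : HasDerivAt (fun t : ℝ => t / (1 + t * a)) 1 0 := by
    have := (hasDerivAt_id (0 : ℝ)).div hd (by simp)
    refine HasDerivAt.congr_deriv (f := fun t : ℝ => t / (1 + t * a)) this ?_
    simp
  have hcomp : HasDerivAt (fun t : ℝ => F (x + (t / (1 + t * a)) • v)) 0 0 := by
    have := HasDerivAt.comp (h := fun t : ℝ => t / (1 + t * a)) (h₂ := fun t : ℝ => F (x + t • v))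
      (h₂' := 0) (0 : ℝ) (by simpa using h0) hq
    simpa [Function.comp_def] using this
  have hm := hd.mul hcomp
  have hev : (fun t : ℝ => F (x + t • (v + a • x))) =ᶠ[𝓝 0]
      ((fun t : ℝ => 1 + t * a) * fun t : ℝ => F (x + (t / (1 + t * a)) • v)) := by
    have hc : Continuous fun t : ℝ => 1 + t * a := by fun_prop
    have : ∀ᶠ t : ℝ in 𝓝 0, 0 < 1 + t * a :=
      hc.continuousAt.eventually (lt_mem_nhds (by simp))
    filter_upwards [this] with t ht
    simp only [Pi.mul_apply]
    rw [← hhom _ _ ht.le]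
    congr 1
    rw [smul_add (1 + t * a), smul_smul (1 + t * a), mul_div_cancel₀ _ ht.ne']
    module
  refine (hm.congr_of_eventuallyEq hev).congr_deriv ?_
  simp

lemma span_D (D : ℝ → ℝ → ℝ → Prop)
    (hD : ∀ α β a1 a2 a3 b1 b2 b3, D a1 a2 a3 → D b1 b2 b3 →
      D (α * a1 + β * b1) (α * a2 + β * b2) (α * a3 + β * b3))
    (x0 x1 x2 p1 p2 p3 q1 q2 q3 r1 r2 r3 n1 n2 n3 : ℝ)
    (h1 : n1 = x0 * (q2 * r3 - q3 * r2) + x1 * (r2 * p3 - r3 * p2) + x2 * (p2 * q3 - p3 * q2))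
    (h2 : n2 = x0 * (q3 * r1 - q1 * r3) + x1 * (r3 * p1 - r1 * p3) + x2 * (p3 * q1 - p1 * q3))
    (h3 : n3 = x0 * (q1 * r2 - q2 * r1) + x1 * (r1 * p2 - r2 * p1) + x2 * (p1 * q2 - p2 * q1))
    (h01 : D (x1 * p1 - x0 * q1) (x1 * p2 - x0 * q2) (x1 * p3 - x0 * q3))
    (h12 : D (x2 * q1 - x1 * r1) (x2 * q2 - x1 * r2) (x2 * q3 - x1 * r3))
    (h20 : D (x0 * r1 - x2 * p1) (x0 * r2 - x2 * p2) (x0 * r3 - x2 * p3))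
    (hn : n1 ≠ 0 ∨ n2 ≠ 0 ∨ n3 ≠ 0) (u1 u2 u3 : ℝ) (hu : n1 * u1 + n2 * u2 + n3 * u3 = 0) :
    D u1 u2 u3 := by
  have hpos : 0 < n1 ^ 2 + n2 ^ 2 + n3 ^ 2 := by
    rcases hn with h | h | h <;> have := sq_pos_of_ne_zero h <;> positivity
  have key : ∀ A1 A2 A3 B1 B2 B3 s : ℝ, s ≠ 0 → D A1 A2 A3 → D B1 B2 B3 →
      A2 * B3 - A3 * B2 = s * n1 → A3 * B1 - A1 * B3 = s * n2 → A1 * B2 - A2 * B1 = s * n3 →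
      D u1 u2 u3 := by
    intro A1 A2 A3 B1 B2 B3 s hs hA hB e1 e2 e3
    have hM : s * (n1 ^ 2 + n2 ^ 2 + n3 ^ 2) ≠ 0 := mul_ne_zero hs hpos.ne'
    have := hD
      (((n2 * u3 - n3 * u2) * B1 + (n3 * u1 - n1 * u3) * B2 + (n1 * u2 - n2 * u1) * B3)
        / (s * (n1 ^ 2 + n2 ^ 2 + n3 ^ 2)))
      (-((n2 * u3 - n3 * u2) * A1 + (n3 * u1 - n1 * u3) * A2 + (n1 * u2 - n2 * u1) * A3)
        / (s * (n1 ^ 2 + n2 ^ 2 + n3 ^ 2))) _ _ _ _ _ _ hA hB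
    convert this using 1
    · rw [div_mul_eq_mul_div, div_mul_eq_mul_div, ← add_div, eq_div_iff hM]
      linear_combination -(n3 * u1 - n1 * u3) * e3 + (n1 * u2 - n2 * u1) * e2 + s * n1 * hu
    · rw [div_mul_eq_mul_div, div_mul_eq_mul_div, ← add_div, eq_div_iff hM]
      linear_combination -(n1 * u2 - n2 * u1) * e1 + (n2 * u3 - n3 * u2) * e3 + s * n2 * hu
    · rw [div_mul_eq_mul_div, div_mul_eq_mul_div, ← add_div, eq_div_iff hM]
      linear_combination -(n2 * u3 - n3 * u2) * e2 + (n3 * u1 - n1 * u3) * e1 + s * n3 * hu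
  by_cases hx0 : x0 = 0
  · by_cases hx1 : x1 = 0
    · by_cases hx2 : x2 = 0
      · exfalso
        rw [hx0, hx1, hx2] at h1 h2 h3
        rcases hn with h | h | h <;> apply h
        · rw [h1]; ring
        · rw [h2]; ring
        · rw [h3]; ring
      · exact key _ _ _ _ _ _ x2 hx2 h12 h20 (by rw [h1]; ring) (by rw [h2]; ring) (by rw [h3]; ring)
    · exact key _ _ _ _ _ _ x1 hx1 h01 h12 (by rw [h1]; ring) (by rw [h2]; ring) (by rw [h3]; ring)
  · exact key _ _ _ _ _ _ x0 hx0 h20 h01 (by rw [h1]; ring) (by rw [h2]; ring) (by rw [h3]; ring)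

/-- Ternary cubic forms. -/
def Cub (f : ℝ → ℝ → ℝ → ℝ) : Prop := ∃ a0 a1 a2 a3 a4 a5 a6 a7 a8 a9 : ℝ, ∀ x y z,
  f x y z = a0 * z ^ 3 + ((a1 * x + a2 * y) * z ^ 2 + (a3 * x ^ 2 + a4 * x * y + a5 * y ^ 2) * z
      + (a6 * x ^ 3 + a7 * x ^ 2 * y + a8 * x * y ^ 2 + a9 * y ^ 3))

lemma cub_add (f h : ℝ → ℝ → ℝ → ℝ) (hf : Cub f) (hh : Cub h) :
    Cub (fun x y z => f x y z + h x y z) := by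
  obtain ⟨a0, a1, a2, a3, a4, a5, a6, a7, a8, a9, ha⟩ := hf
  obtain ⟨b0, b1, b2, b3, b4, b5, b6, b7, b8, b9, hb⟩ := hh
  refine ⟨a0 + b0, a1 + b1, a2 + b2, a3 + b3, a4 + b4, a5 + b5, a6 + b6, a7 + b7, a8 + b8,
    a9 + b9, fun x y z => ?_⟩
  simp only [ha, hb]; ring

lemma cub_mul (f : ℝ → ℝ → ℝ → ℝ) (l m n : ℝ → ℝ → ℝ → ℝ) (l1 l2 l3 m1 m2 m3 n1 n2 n3 : ℝ)
    (hl : ∀ x y z, l x y z = l1 * x + l2 * y + l3 * z)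
    (hm : ∀ x y z, m x y z = m1 * x + m2 * y + m3 * z)
    (hn : ∀ x y z, n x y z = n1 * x + n2 * y + n3 * z)
    (hf : ∀ x y z, f x y z = l x y z * m x y z * n x y z) : Cub f := by
  refine ⟨l3 * m3 * n3, l1 * m3 * n3 + l3 * m1 * n3 + l3 * m3 * n1,
    l2 * m3 * n3 + l3 * m2 * n3 + l3 * m3 * n2,
    l1 * m1 * n3 + l1 * m3 * n1 + l3 * m1 * n1,
    l1 * m2 * n3 + l2 * m1 * n3 + l1 * m3 * n2 + l2 * m3 * n1 + l3 * m1 * n2 + l3 * m2 * n1,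
    l2 * m2 * n3 + l2 * m3 * n2 + l3 * m2 * n2,
    l1 * m1 * n1, l1 * m1 * n2 + l1 * m2 * n1 + l2 * m1 * n1,
    l1 * m2 * n2 + l2 * m1 * n2 + l2 * m2 * n1, l2 * m2 * n2, fun x y z => ?_⟩
  simp only [hf, hl, hm, hn]; ring

/-- Ternary linear forms. -/
def Lin3 (l : ℝ → ℝ → ℝ → ℝ) : Prop := ∃ a b c : ℝ, ∀ x y z, l x y z = a * x + b * y + c * z

lemma cub_det (X0 X1 X2 p q r p' q' r' : ℝ → ℝ → ℝ → ℝ) (hX0 : Lin3 X0) (hX1 : Lin3 X1)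
    (hX2 : Lin3 X2) (hp : Lin3 p) (hq : Lin3 q) (hr : Lin3 r) (hp' : Lin3 p') (hq' : Lin3 q')
    (hr' : Lin3 r') : Cub (fun x y z => X0 x y z * (q x y z * r' x y z - q' x y z * r x y z)
      + X1 x y z * (r x y z * p' x y z - r' x y z * p x y z)
      + X2 x y z * (p x y z * q' x y z - p' x y z * q x y z)) := by
  have base : ∀ l m n : ℝ → ℝ → ℝ → ℝ, Lin3 l → Lin3 m → Lin3 n →
      Cub (fun x y z => l x y z * (m x y z * n x y z)) := by
    rintro l m n ⟨_, _, _, hl⟩ ⟨_, _, _, hm⟩ ⟨_, _, _, hn⟩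
    exact cub_mul _ l m n _ _ _ _ _ _ _ _ _ hl hm hn (fun x y z => by ring)
  have baseN : ∀ l m n : ℝ → ℝ → ℝ → ℝ, Lin3 l → Lin3 m → Lin3 n →
      Cub (fun x y z => l x y z * (-(m x y z * n x y z))) := by
    rintro l m n ⟨a, b, c, hl⟩ ⟨_, _, _, hm⟩ ⟨_, _, _, hn⟩
    exact cub_mul _ (fun x y z => -l x y z) m n (-a) (-b) (-c) _ _ _ _ _ _
      (fun x y z => by rw [hl]; ring) hm hn (fun x y z => by ring)
  have := cub_add _ _ (cub_add _ _ (cub_add _ _ (base _ _ _ hX0 hq hr') (baseN _ _ _ hX0 hq' hr))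
    (cub_add _ _ (base _ _ _ hX1 hr hp') (baseN _ _ _ hX1 hr' hp)))
    (cub_add _ _ (base _ _ _ hX2 hp hq') (baseN _ _ _ hX2 hp' hq))
  convert this using 4
  ring

lemma cross_zero (x0 x1 x2 p2 p3 q2 q3 r2 r3 l0 l1 l2 m0 m1 m2 : ℝ)
    (h1 : x0 * (q2 * r3 - q3 * r2) + x1 * (r2 * p3 - r3 * p2) + x2 * (p2 * q3 - p3 * q2) = 0)
    (hx : x0 ≠ 0 ∨ x1 ≠ 0 ∨ x2 ≠ 0)
    (hl : l0 * x0 + l1 * x1 + l2 * x2 = 0) (hm : m0 * x0 + m1 * x1 + m2 * x2 = 0) :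
    (l0 * p2 + l1 * q2 + l2 * r2) * (m0 * p3 + m1 * q3 + m2 * r3)
      - (l0 * p3 + l1 * q3 + l2 * r3) * (m0 * p2 + m1 * q2 + m2 * r2) = 0 := by
  rcases hx with h | h | h <;> apply mul_left_cancel₀ h
  · linear_combination (l1 * m2 - l2 * m1) * h1 +
      (r2 * p3 - r3 * p2) * (-m2 * hl + l2 * hm) + (p2 * q3 - p3 * q2) * (m1 * hl - l1 * hm)
  · linear_combination (l2 * m0 - l0 * m2) * h1 +
      (p2 * q3 - p3 * q2) * (-m0 * hl + l0 * hm) + (q2 * r3 - q3 * r2) * (m2 * hl - l2 * hm)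
  · linear_combination (l0 * m1 - l1 * m0) * h1 +
      (q2 * r3 - q3 * r2) * (-m1 * hl + l1 * hm) + (r2 * p3 - r3 * p2) * (m0 * hl - l0 * hm)

lemma core {X : Type*} [NormedAddCommGroup X] [NormedSpace ℝ X] (F : X → ℝ) (hcont : Continuous F)
    (hsub : ∀ x y, F (x + y) ≤ F x + F y) (hhom : ∀ (s : ℝ) x, 0 ≤ s → F (s • x) = s * F x)
    (hpos : ∀ x, x ≠ 0 → 0 < F x) (L : ℝ) (hL0 : 0 ≤ L) (hL : ∀ x, F x ≤ L * ‖x‖)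
    (b : Module.Basis (Fin 3) ℝ X) (R : Module.Dual ℝ X →ₗ[ℝ] (X →ₗ[ℝ] X))
    (hflat : ∀ (lam : Module.Dual ℝ X) x, x ≠ 0 → lam x = 0 → FlatD F x (R lam x))
    (hsup : ∀ x, b.coord 2 x ≤ F x) (hF2 : F (b 2) = 1)
    (hdeg : ∃ v, ∀ lam : Module.Dual ℝ X, lam (b 2) = 0 → ∃ c : ℝ, R lam (b 2) = c • v)
    (p : X) (hp : p ≠ 0)
    (hnd : ¬ ∃ v, ∀ lam : Module.Dual ℝ X, lam p = 0 → ∃ c : ℝ, R lam p = c • v) :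
    ∃ α β γ : ℝ, ∀ x, F x ^ 2 = b.coord 2 x ^ 2 + (α * b.coord 0 x ^ 2
      + β * b.coord 0 x * b.coord 1 x + γ * b.coord 1 x ^ 2) := by
  obtain ⟨pt, hpt⟩ : ∃ pt : ℝ → ℝ → ℝ → X, ∀ x y z, pt x y z = x • b 0 + y • b 1 + z • b 2 :=
    ⟨_, fun _ _ _ => rfl⟩
  have hrec : ∀ v, pt (b.coord 0 v) (b.coord 1 v) (b.coord 2 v) = v := by
    intro v
    rw [hpt]
    have := b.sum_repr v
    rw [Fin.sum_univ_three] at this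
    simpa using this
  have hc0 : ∀ x y z, b.coord 0 (pt x y z) = x := by intro x y z; simp [hpt]
  have hc1 : ∀ x y z, b.coord 1 (pt x y z) = y := by intro x y z; simp [hpt]
  have hc2 : ∀ x y z, b.coord 2 (pt x y z) = z := by intro x y z; simp [hpt]
  have hext : ∀ u v, b.coord 0 u = b.coord 0 v → b.coord 1 u = b.coord 1 v →
      b.coord 2 u = b.coord 2 v → u = v := by
    intro u v h0 h1 h2
    rw [← hrec u, ← hrec v, h0, h1, h2]
  have hptne : ∀ x y z, (x ≠ 0 ∨ y ≠ 0 ∨ z ≠ 0) → pt x y z ≠ 0 := by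
    intro x y z h h0
    have e0 := hc0 x y z
    have e1 := hc1 x y z
    have e2 := hc2 x y z
    rw [h0, map_zero] at e0 e1 e2
    rcases h with h | h | h
    · exact h e0.symm
    · exact h e1.symm
    · exact h e2.symm
  obtain ⟨l, hl⟩ : ∃ l : Fin 3 → Fin 3 → ℝ → ℝ → ℝ → ℝ, ∀ i k x y z,
      l i k x y z = b.coord k (R (b.coord i) (pt x y z)) := ⟨_, fun _ _ _ _ _ => rfl⟩
  have hlin : ∀ i k, Lin3 (l i k) := by
    intro i k
    refine ⟨b.coord k (R (b.coord i) (b 0)), b.coord k (R (b.coord i) (b 1)),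
      b.coord k (R (b.coord i) (b 2)), fun x y z => ?_⟩
    rw [hl, hpt]
    simp only [map_add, map_smul, smul_eq_mul]
    ring
  have hX0 : Lin3 (fun x _ _ => x) := ⟨1, 0, 0, fun x y z => by ring⟩
  have hX1 : Lin3 (fun _ y _ => y) := ⟨0, 1, 0, fun x y z => by ring⟩
  have hX2 : Lin3 (fun _ _ z => z) := ⟨0, 0, 1, fun x y z => by ring⟩
  have hdet : ∀ j k, ∃ N : ℝ → ℝ → ℝ → ℝ, Cub N ∧ ∀ x y z, N x y z =
      x * (l 1 j x y z * l 2 k x y z - l 1 k x y z * l 2 j x y z)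
      + y * (l 2 j x y z * l 0 k x y z - l 2 k x y z * l 0 j x y z)
      + z * (l 0 j x y z * l 1 k x y z - l 0 k x y z * l 1 j x y z) := fun j k =>
    ⟨_, cub_det _ _ _ _ _ _ _ _ _ hX0 hX1 hX2 (hlin 0 j) (hlin 1 j) (hlin 2 j) (hlin 0 k)
      (hlin 1 k) (hlin 2 k), fun x y z => rfl⟩
  obtain ⟨N1, hCN1, hN1⟩ := hdet 1 2
  obtain ⟨N2, hCN2, hN2⟩ := hdet 2 0
  obtain ⟨N3, hCN3, hN3⟩ := hdet 0 1
  -- degeneracy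
  have hzero : ∀ j k, l 0 j 0 0 1 * l 1 k 0 0 1 - l 0 k 0 0 1 * l 1 j 0 0 1 = 0 := by
    obtain ⟨v, hv⟩ := hdeg
    obtain ⟨c, hc⟩ := hv (b.coord 0) (by simp)
    obtain ⟨d, hd⟩ := hv (b.coord 1) (by simp)
    have hb2 : pt 0 0 1 = b 2 := by simp [hpt]
    intro j k
    simp only [hl, hb2, hc, hd, map_smul, smul_eq_mul]
    ring
  have hz1 : N1 0 0 1 = 0 := by rw [hN1]; linear_combination hzero 1 2
  have hz2 : N2 0 0 1 = 0 := by rw [hN2]; linear_combination hzero 2 0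
  have hz3 : N3 0 0 1 = 0 := by rw [hN3]; linear_combination hzero 0 1
  obtain ⟨a0, a1, a2, a3, a4, a5, a6, a7, a8, a9, ha⟩ := hCN1
  obtain ⟨b0, b1, b2, b3, b4, b5, b6, b7, b8, b9, hb⟩ := hCN2
  obtain ⟨c0, c1, c2, c3, c4, c5, c6, c7, c8, c9, hc⟩ := hCN3
  have ha0 : a0 = 0 := by rw [ha] at hz1; linarith
  have hb0 : b0 = 0 := by rw [hb] at hz2; linarith
  have hcc0 : c0 = 0 := by rw [hc] at hz3; linarith
  -- flat span
  have hspan : ∀ x y z, (N1 x y z ≠ 0 ∨ N2 x y z ≠ 0 ∨ N3 x y z ≠ 0) → ∀ u1 u2 u3,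
      N1 x y z * u1 + N2 x y z * u2 + N3 x y z * u3 = 0 → FlatD F (pt x y z) (pt u1 u2 u3) := by
    intro x y z hN u1 u2 u3 hu
    have hne : pt x y z ≠ 0 := by
      apply hptne
      by_contra hcon
      push Not at hcon
      obtain ⟨rfl, rfl, rfl⟩ := hcon
      rw [hN1, hN2, hN3] at hN
      simp at hN
    have hV : ∀ i j : Fin 3, ∀ s t : ℝ, s * b.coord i (pt x y z) - t * b.coord j (pt x y z) = 0 →
        FlatD F (pt x y z) (pt (s * l i 0 x y z - t * l j 0 x y z)
          (s * l i 1 x y z - t * l j 1 x y z) (s * l i 2 x y z - t * l j 2 x y z)) := by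
      intro i j s t hst
      have := hflat (s • b.coord i - t • b.coord j) (pt x y z) hne (by
        simpa only [LinearMap.sub_apply, LinearMap.smul_apply, smul_eq_mul] using hst)
      convert this using 1
      apply hext
      · rw [hc0, hl, hl]
        simp only [map_sub, map_smul, LinearMap.sub_apply, LinearMap.smul_apply, smul_eq_mul]
      · rw [hc1, hl, hl]
        simp only [map_sub, map_smul, LinearMap.sub_apply, LinearMap.smul_apply, smul_eq_mul]
      · rw [hc2, hl, hl]
        simp only [map_sub, map_smul, LinearMap.sub_apply, LinearMap.smul_apply, smul_eq_mul]
    refine span_D (fun a b c => FlatD F (pt x y z) (pt a b c)) ?_ x y z _ _ _ _ _ _ _ _ _ _ _ _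
      (hN1 x y z) (hN2 x y z) (hN3 x y z) (hV 0 1 y x (by rw [hc0, hc1]; ring))
      (hV 1 2 z y (by rw [hc1, hc2]; ring)) (hV 2 0 x z (by rw [hc0, hc2]; ring)) hN u1 u2 u3 hu
    intro α β a1 a2 a3 b1 b2 b3 hA hB
    have := flatD_comb F hsub hhom _ _ _ α β hA hB
    convert this using 1
    simp only [hpt]
    module
  obtain ⟨g, hg⟩ : ∃ g : ℝ → ℝ → ℝ → ℝ, ∀ x y z,
    g x y z = x * N1 x y z + y * N2 x y z + z * N3 x y z := ⟨_, fun _ _ _ => rfl⟩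
  have hgN : ∀ x y z, g x y z ≠ 0 → (N1 x y z ≠ 0 ∨ N2 x y z ≠ 0 ∨ N3 x y z ≠ 0) := by
    intro x y z h
    by_contra hcon
    push Not at hcon
    apply h
    rw [hg, hcon.1, hcon.2.1, hcon.2.2]; ring
  have hNg : ∀ x y z, (N1 x y z ≠ 0 ∨ N2 x y z ≠ 0 ∨ N3 x y z ≠ 0) → g x y z ≠ 0 := by
    intro x y z h hg0
    have h1 := hspan x y z h x y z (by rw [hg] at hg0; linarith)
    have hne : pt x y z ≠ 0 := by
      apply hptne
      by_contra hcon
      push Not at hcon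
      obtain ⟨rfl, rfl, rfl⟩ := hcon
      rw [hN1, hN2, hN3] at h
      simp at h
    exact not_flat_self F hhom _ (hpos _ hne) h1.1
  have hder : ∀ x y z a b c, g x y z ≠ 0 →
      HasDerivAt (fun s : ℝ => F (pt x y z + s • pt a b c))
      (F (pt x y z) * (a * N1 x y z + b * N2 x y z + c * N3 x y z) / g x y z) 0 := by
    intro x y z a b c h
    set k := (a * N1 x y z + b * N2 x y z + c * N3 x y z) / g x y z with hk
    have h1 := hspan x y z (hgN x y z h) (a - k * x) (b - k * y) (c - k * z) (by
      have : k * g x y z = a * N1 x y z + b * N2 x y z + c * N3 x y z := by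
        rw [hk]; field_simp
      rw [hg] at this
      linear_combination -this)
    have h2 := flatD_deriv_add F hsub hhom _ _ k h1
    have e : pt (a - k * x) (b - k * y) (c - k * z) + k • pt x y z = pt a b c := by
      simp only [hpt]; module
    rw [e] at h2
    refine h2.congr_deriv ?_
    rw [hk]; ring
  have hlip : ∀ x w : X, ∀ s : ℝ, |F (x + s • w) - F x| ≤ L * ‖w‖ * |s| := by
    intro x w s
    have h1 := hsub x (s • w)
    have h2 := hL (s • w)
    have h3 := hsub (x + s • w) (-(s • w))
    have h4 := hL (-(s • w))
    rw [norm_neg] at h4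
    rw [norm_smul, Real.norm_eq_abs] at h2 h4
    rw [add_neg_cancel_right] at h3
    rw [abs_le]
    constructor <;> nlinarith
  have hbd : ∀ a b c, ∃ C, ∀ x y z, |a * N1 x y z + b * N2 x y z + c * N3 x y z| * F (pt x y z)
      ≤ C * |g x y z| := by
    intro a b c
    refine ⟨L * ‖pt a b c‖, fun x y z => ?_⟩
    have hC0 : 0 ≤ L * ‖pt a b c‖ := by positivity
    by_cases h : N1 x y z ≠ 0 ∨ N2 x y z ≠ 0 ∨ N3 x y z ≠ 0
    · have hgne := hNg x y z h
      have h1 := HasDerivAt.le_of_lip' (hder x y z a b c hgne) hC0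
        (Eventually.of_forall fun s => by
          have := hlip (pt x y z) (pt a b c) s
          simpa using this)
      have hF0 : 0 ≤ F (pt x y z) := by
        by_cases h0 : pt x y z = 0
        · have := hhom 0 0 le_rfl
          rw [h0]; simp at this; rw [this]
        · exact (hpos _ h0).le
      rw [Real.norm_eq_abs, abs_div, abs_mul, abs_of_nonneg hF0,
        div_le_iff₀ (abs_pos.2 hgne)] at h1
      linarith
    · push Not at h
      rw [h.1, h.2.1, h.2.2]
      simp
      positivity
  have hgne : ∃ x y z, g x y z ≠ 0 := by
    refine ⟨b.coord 0 p, b.coord 1 p, b.coord 2 p, hNg _ _ _ ?_⟩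
    by_contra hcon
    push Not at hcon
    obtain ⟨e1, e2, e3⟩ := hcon
    rw [hN1] at e1
    rw [hN2] at e2
    rw [hN3] at e3
    simp only [hl, hrec] at e1 e2 e3
    have hpc : b.coord 0 p ≠ 0 ∨ b.coord 1 p ≠ 0 ∨ b.coord 2 p ≠ 0 := by
      by_contra hcon
      push Not at hcon
      apply hp
      apply hext <;> simp only [map_zero]
      exacts [hcon.1, hcon.2.1, hcon.2.2]
    have hlam : ∀ lam : Module.Dual ℝ X, lam = lam (b 0) • b.coord 0 + lam (b 1) • b.coord 1
        + lam (b 2) • b.coord 2 := by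
      intro lam
      apply b.ext
      intro i
      fin_cases i <;> simp
    have hlamp : ∀ lam : Module.Dual ℝ X, lam p = lam (b 0) * b.coord 0 p + lam (b 1) * b.coord 1 p
        + lam (b 2) * b.coord 2 p := by
      intro lam
      conv_lhs => rw [hlam lam]
      simp only [LinearMap.add_apply, LinearMap.smul_apply, smul_eq_mul]
    have hRlam : ∀ (lam : Module.Dual ℝ X) k, b.coord k (R lam p) =
        lam (b 0) * b.coord k (R (b.coord 0) p) + lam (b 1) * b.coord k (R (b.coord 1) p)
        + lam (b 2) * b.coord k (R (b.coord 2) p) := by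
      intro lam k
      conv_lhs => rw [hlam lam]
      simp only [map_add, map_smul, LinearMap.add_apply, LinearMap.smul_apply, smul_eq_mul]
    apply hnd
    by_cases hall : ∀ lam : Module.Dual ℝ X, lam p = 0 → R lam p = 0
    · exact ⟨0, fun lam h => ⟨0, by rw [hall lam h]; simp⟩⟩
    push Not at hall
    obtain ⟨mu, hmu, hmune⟩ := hall
    refine ⟨R mu p, fun lam h => ?_⟩
    have h' := h
    have hmu' := hmu
    rw [hlamp] at h' hmu'
    have k1 := cross_zero _ _ _ _ _ _ _ _ _ _ _ _ _ _ _ e1 hpc h' hmu'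
    have k2 := cross_zero _ _ _ _ _ _ _ _ _ _ _ _ _ _ _ e2 hpc h' hmu'
    have k3 := cross_zero _ _ _ _ _ _ _ _ _ _ _ _ _ _ _ e3 hpc h' hmu'
    rw [← hRlam, ← hRlam, ← hRlam, ← hRlam] at k1 k2 k3
    have hmc : b.coord 0 (R mu p) ≠ 0 ∨ b.coord 1 (R mu p) ≠ 0 ∨ b.coord 2 (R mu p) ≠ 0 := by
      by_contra hcon
      push Not at hcon
      apply hmune
      apply hext <;> simp only [map_zero]
      exacts [hcon.1, hcon.2.1, hcon.2.2]
    rcases hmc with hm | hm | hm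
    · refine ⟨b.coord 0 (R lam p) / b.coord 0 (R mu p), ?_⟩
      apply hext <;> simp only [map_smul, smul_eq_mul] <;> field_simp <;> linarith
    · refine ⟨b.coord 1 (R lam p) / b.coord 1 (R mu p), ?_⟩
      apply hext <;> simp only [map_smul, smul_eq_mul] <;> field_simp <;> linarith
    · refine ⟨b.coord 2 (R lam p) / b.coord 2 (R mu p), ?_⟩
      apply hext <;> simp only [map_smul, smul_eq_mul] <;> field_simp <;> linarith
  subst ha0 hb0 hcc0
  obtain ⟨α, β, γ, hfin⟩ := propA (fun x y z => F (pt x y z))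
    (by simp only [hpt]; fun_prop)
    (fun s x y z hs => by
      rw [← hhom s _ hs]; congr 1; simp only [hpt]; module)
    (fun x y z h => hpos _ (hptne x y z h))
    (fun x y z => by have := hsup (pt x y z); rwa [hc2] at this)
    (by simp [hpt, hF2]) N1 N2 N3 g a1 a2 a3 a4 a5 a6 a7 a8 a9 b1 b2 b3 b4 b5 b6 b7 b8 b9
    c1 c2 c3 c4 c5 c6 c7 c8 c9
    (fun x y z => by rw [ha]; ring) (fun x y z => by rw [hb]; ring) (fun x y z => by rw [hc]; ring)
    hg hbd
    (fun x y z a b c h => by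
      have h1 := hder x y z a b c h
      have e : (fun s : ℝ => F (pt (x + s * a) (y + s * b) (z + s * c)))
          = fun s : ℝ => F (pt x y z + s • pt a b c) := by
        funext s; congr 1; simp only [hpt]; module
      rw [e]; exact h1) hgne
  refine ⟨α, β, γ, fun x => ?_⟩
  have := hfin (b.coord 0 x) (b.coord 1 x) (b.coord 2 x)
  rwa [hrec] at this

lemma tangent_flat {X : Type*} [NormedAddCommGroup X] [NormedSpace ℝ X] (K : Set X) (F : X → ℝ)
    (hsub : ∀ x y, F (x + y) ≤ F x + F y) (L : ℝ) (hL0 : 0 ≤ L) (hL : ∀ x, F x ≤ L * ‖x‖)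
    (hfr : ∀ x, x ∈ frontier K → F x = 1) (x v : X) (hx : x ∈ frontier K)
    (h : IsForwardTangent K x v) : FlatDir F x v := by
  obtain ⟨p, c, hp, hc, -, hlim⟩ := h
  intro ε hε
  have hδ : 0 < ε / (L + 1) := by positivity
  obtain ⟨i, hi⟩ := ((Metric.tendsto_nhds.1 hlim) _ hδ).exists
  have hci := hc i
  refine ⟨(c i)⁻¹, by positivity, ?_⟩
  have e : x + (c i)⁻¹ • v = p i + (c i)⁻¹ • (v - c i • (p i - x)) := by
    rw [smul_sub, smul_smul, inv_mul_cancel₀ hci.ne', one_smul]; abel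
  have h1 := hsub (p i) ((c i)⁻¹ • (v - c i • (p i - x)))
  have h2 := hL ((c i)⁻¹ • (v - c i • (p i - x)))
  rw [← e, hfr _ (hp i)] at h1
  rw [hfr _ hx]
  rw [norm_smul, Real.norm_eq_abs, abs_of_pos (by positivity), ← dist_eq_norm, dist_comm] at h2
  have h3 : L * dist (c i • (p i - x)) v ≤ ε := by
    calc L * dist (c i • (p i - x)) v ≤ L * (ε / (L + 1)) :=
          mul_le_mul_of_nonneg_left hi.le hL0
      _ ≤ (L + 1) * (ε / (L + 1)) := mul_le_mul_of_nonneg_right (by linarith) hδ.le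
      _ = ε := by field_simp
  have h4 : 0 < (c i)⁻¹ := by positivity
  nlinarith [mul_le_mul_of_nonneg_left h3 h4.le]

lemma exists_support_basis {X : Type*} [AddCommGroup X] [Module ℝ X]
    (hdim : Module.finrank ℝ X = 3) (F : X → ℝ)
    (hsub : ∀ x y, F (x + y) ≤ F x + F y) (hhom : ∀ (s : ℝ) x, 0 ≤ s → F (s • x) = s * F x)
    (hnn : ∀ x, 0 ≤ F x) (p : X) (hp : p ≠ 0) (hFp : F p = 1) :
    ∃ b : Module.Basis (Fin 3) ℝ X, b 2 = p ∧ ∀ x, b.coord 2 x ≤ F x := by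
  haveI : Module.Finite ℝ X := Module.finite_of_finrank_pos (by omega)
  obtain ⟨g, hg1, hg2⟩ := exists_extension_of_le_sublinear
    (LinearPMap.mkSpanSingleton (σ := RingHom.id ℝ) p (1 : ℝ) hp) F (fun c hc x => hhom c x hc.le)
    hsub (by
      rintro ⟨x, hx⟩
      obtain ⟨c, rfl⟩ := Submodule.mem_span_singleton.1 hx
      have e : (LinearPMap.mkSpanSingleton (σ := RingHom.id ℝ) p (1 : ℝ) hp) ⟨c • p, hx⟩
          = (RingHom.id ℝ c) • (1 : ℝ) := LinearPMap.mkSpanSingleton'_apply _ _ _ c hx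
      rw [e]
      simp only [RingHom.id_apply, smul_eq_mul, mul_one]
      rcases le_total 0 c with h | h
      · rw [hhom c p h, hFp, mul_one]
      · exact h.trans (hnn _))
  have hgp : g p = 1 := by
    have := hg1 ⟨p, Submodule.mem_span_singleton_self p⟩
    rw [this]
    exact LinearPMap.mkSpanSingleton_apply ℝ ℝ (σ := RingHom.id ℝ) hp (1 : ℝ)
  have hker : Module.finrank ℝ (LinearMap.ker g) = 2 := by
    have h1 := LinearMap.finrank_range_add_finrank_ker g
    have h2 : LinearMap.range g = ⊤ := by
      rw [LinearMap.range_eq_top]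
      intro c
      exact ⟨c • p, by simp [hgp]⟩
    rw [h2, finrank_top, Module.finrank_self, hdim] at h1
    omega
  let c := Module.finBasisOfFinrankEq ℝ (LinearMap.ker g) hker
  have hk0 : g (c 0 : X) = 0 := (c 0).2
  have hk1 : g (c 1 : X) = 0 := (c 1).2
  have hli : LinearIndependent ℝ ![(c 0 : X), (c 1 : X), p] := by
    rw [Fintype.linearIndependent_iff]
    intro a ha
    rw [Fin.sum_univ_three] at ha
    simp only [Matrix.cons_val_zero, Matrix.cons_val_one, Matrix.cons_val] at ha
    have h2 : a 2 = 0 := by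
      have := congrArg g ha
      simpa [hk0, hk1, hgp] using this
    have h3 := Fintype.linearIndependent_iff.1 c.linearIndependent ![a 0, a 1] (by
      rw [Fin.sum_univ_two]
      apply Subtype.ext
      simpa [h2] using ha)
    intro i
    fin_cases i
    · simpa using h3 0
    · simpa using h3 1
    · exact h2
  let b := basisOfLinearIndependentOfCardEqFinrank hli (by simp [hdim])
  have hb0 : b 0 = c 0 := by simp [b]
  have hb1 : b 1 = c 1 := by simp [b]
  have hb2 : b 2 = p := by simp [b]
  have hgb : g = b.coord 2 := by
    apply b.ext
    intro i
    fin_cases i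
    · simp [hb0, hk0]
      rw [← hb0]; simp
    · simp [hb1, hk1]
      rw [← hb1]; simp
    · simp [hb2, hgp]
      rw [← hb2]; simp
  exact ⟨b, hb2, fun x => by rw [← hgb]; exact hg2 x⟩

/-- **Proposition (partly degenerate case).**  Let `dim X = 3`, `K ⊂ X` a convex body with
`0` in its interior and `R : X* → End(X)` a linear map with trace-free values satisfying the
tangency assumption: `R_λ(x)` is tangent to `∂K` at `x` whenever `x ∈ ∂K` and `λ(x) = 0`.
If there exist `p₀, p₁ ≠ 0` with `dim T^R_{p₀} ≤ 1` and `dim T^R_{p₁} = 2`, then `K` is an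
ellipsoid centered at `0`. -/
theorem ellipsoid_of_partly_degenerate
    {X : Type*} [NormedAddCommGroup X] [NormedSpace ℝ X]
    (hdim : Module.finrank ℝ X = 3)
    (K : Set X) (hKcomp : IsCompact K) (hKconv : Convex ℝ K)
    (h0 : (0 : X) ∈ interior K)
    (R : Module.Dual ℝ X →ₗ[ℝ] (X →ₗ[ℝ] X))
    (htr : ∀ lam : Module.Dual ℝ X, LinearMap.trace ℝ X (R lam) = 0)
    (htang : ∀ lam : Module.Dual ℝ X, ∀ x ∈ frontier K, lam x = 0 →
      IsTangentVec K x (R lam x))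
    (p₀ : X) (hp₀ : p₀ ≠ 0)
    (hdeg : Module.finrank ℝ (Submodule.span ℝ (TR R p₀)) ≤ 1)
    (p₁ : X) (hp₁ : p₁ ≠ 0)
    (hnondeg : Module.finrank ℝ (Submodule.span ℝ (TR R p₁)) = 2) :
    IsEllipsoid K := by
  haveI : Module.Finite ℝ X := Module.finite_of_finrank_pos (by omega)
  have hnhds : K ∈ 𝓝 (0 : X) := mem_interior_iff_mem_nhds.1 h0
  have habs : Absorbent ℝ K := absorbent_nhds_zero hnhds
  have hbdd : Bornology.IsVonNBounded ℝ K := hKcomp.isVonNBounded ℝ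
  have hsub := gauge_add_le hKconv habs
  have hhom : ∀ (s : ℝ) (x : X), 0 ≤ s → gauge K (s • x) = s * gauge K x := fun s x hs =>
    gauge_smul_of_nonneg hs x
  have hpos : ∀ x : X, x ≠ 0 → 0 < gauge K x := fun x hx => (gauge_pos habs hbdd).2 hx
  obtain ⟨r, hr, hball⟩ := Metric.mem_nhds_iff.1 hnhds
  have hL : ∀ x : X, gauge K x ≤ r⁻¹ * ‖x‖ := fun x => by
    have := mul_gauge_le_norm (x := x) hball
    rw [inv_mul_eq_div, le_div_iff₀ hr]
    linarith
  have hL0 : 0 ≤ r⁻¹ := by positivity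
  have hfr : ∀ x, x ∈ frontier K → gauge K x = 1 := fun x hx =>
    (gauge_eq_one_iff_mem_frontier hKconv hnhds).2 hx
  have hcont : Continuous (gauge K) := continuous_gauge hKconv hnhds
  have hflat : ∀ (lam : Module.Dual ℝ X) x, x ≠ 0 → lam x = 0 → FlatD (gauge K) x (R lam x) := by
    intro lam x hx hlam
    have hFx := hpos x hx
    have hmem : (gauge K x)⁻¹ • x ∈ frontier K := by
      rw [← gauge_eq_one_iff_mem_frontier hKconv hnhds, hhom _ _ (by positivity),
        inv_mul_cancel₀ hFx.ne']
    obtain ⟨h1, h2⟩ := htang lam _ hmem (by rw [map_smul, hlam, smul_zero])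
    have k1 := flat_scale (gauge K) hhom _ _ (gauge K x) hFx
      (tangent_flat K (gauge K) hsub r⁻¹ hL0 hL hfr _ _ hmem h1)
    have k2 := flat_scale (gauge K) hhom _ _ (gauge K x) hFx
      (tangent_flat K (gauge K) hsub r⁻¹ hL0 hL hfr _ _ hmem h2)
    rw [smul_smul, mul_inv_cancel₀ hFx.ne', one_smul] at k1 k2
    have := flatD_smul (gauge K) x _ (gauge K x) ⟨k1, k2⟩
    rwa [map_smul, smul_smul, mul_inv_cancel₀ hFx.ne', one_smul] at this
  have hF0 := hpos p₀ hp₀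
  obtain ⟨b, hb2, hsup⟩ := exists_support_basis hdim (gauge K) hsub hhom (fun x => gauge_nonneg x)
    ((gauge K p₀)⁻¹ • p₀) (smul_ne_zero (inv_ne_zero hF0.ne') hp₀)
    (by rw [hhom _ _ (by positivity), inv_mul_cancel₀ hF0.ne'])
  have hdeg' : ∃ v, ∀ lam : Module.Dual ℝ X, lam (b 2) = 0 → ∃ c : ℝ, R lam (b 2) = c • v := by
    obtain ⟨v, hv⟩ := finrank_le_one_iff.1 hdeg
    refine ⟨v, fun lam h => ?_⟩
    rw [hb2, map_smul, smul_eq_zero] at h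
    have hl := h.resolve_left (inv_ne_zero hF0.ne')
    obtain ⟨c, hc⟩ := hv ⟨R lam p₀, Submodule.subset_span ⟨lam, hl, rfl⟩⟩
    have hc' : c • (v : X) = R lam p₀ := congrArg Subtype.val hc
    exact ⟨(gauge K p₀)⁻¹ * c, by rw [hb2, map_smul, ← hc', smul_smul]⟩
  have hnd : ¬ ∃ v, ∀ lam : Module.Dual ℝ X, lam p₁ = 0 → ∃ c : ℝ, R lam p₁ = c • v := by
    rintro ⟨v, hv⟩
    have hle : Submodule.span ℝ (TR R p₁) ≤ Submodule.span ℝ {v} := by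
      rw [Submodule.span_le]
      rintro y ⟨lam, hl, rfl⟩
      obtain ⟨c, hc⟩ := hv lam hl
      exact Submodule.mem_span_singleton.2 ⟨c, hc.symm⟩
    have h1 := Submodule.finrank_mono hle
    have h2 := finrank_span_le_card (R := ℝ) ({v} : Set X)
    simp at h2
    omega
  obtain ⟨α, β, γ, hfin⟩ := core (gauge K) hcont hsub hhom hpos r⁻¹ hL0 hL b R hflat hsup
    (by rw [hb2, hhom _ _ (by positivity), inv_mul_cancel₀ hF0.ne']) hdeg' p₁ hp₁ hnd
  let B : Fin 3 → Fin 3 → (X →ₗ[ℝ] X →ₗ[ℝ] ℝ) := fun i j =>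
    LinearMap.mk₂ ℝ (fun x y => b.coord i x * b.coord j y)
      (fun _ _ _ => by simp only [map_add]; ring) (fun _ _ _ => by simp only [map_smul, smul_eq_mul]; ring)
      (fun _ _ _ => by simp only [map_add]; ring) (fun _ _ _ => by simp only [map_smul, smul_eq_mul]; ring)
  have hB : ∀ i j x y, B i j x y = b.coord i x * b.coord j y := fun i j x y => rfl
  obtain ⟨f, hf⟩ : ∃ f : X →ₗ[ℝ] X →ₗ[ℝ] ℝ, f = B 2 2 + α • B 0 0 + (β / 2) • (B 0 1 + B 1 0)
    + γ • B 1 1 := ⟨_, rfl⟩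
  have hfv : ∀ x y, f x y = b.coord 2 x * b.coord 2 y + α * (b.coord 0 x * b.coord 0 y)
      + β / 2 * (b.coord 0 x * b.coord 1 y + b.coord 1 x * b.coord 0 y)
      + γ * (b.coord 1 x * b.coord 1 y) := by
    intro x y
    rw [hf]
    simp only [LinearMap.add_apply, LinearMap.smul_apply, smul_eq_mul, hB]
  have hff : ∀ x, f x x = gauge K x ^ 2 := by
    intro x
    rw [hfv, hfin]; ring
  refine ⟨f, fun x y => by rw [hfv, hfv]; ring, fun x hx => ?_, ?_⟩
  · rw [hff]
    have := hpos x hx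
    positivity
  · ext x
    rw [Set.mem_setOf_eq, hff, sq_le_one_iff₀ (gauge_nonneg x),
      gauge_le_one_iff_mem_closure hKconv hnhds, hKcomp.isClosed.closure_eq]
end

section
/- Let X be a real vector space with dim X = 3, K ⊂ X a convex body with 0 in its interior, and R : X* → End(X) a linear map with tr R(λ) = 0 for all λ ∈ X*, satisfying the tangency assumption: for every λ ∈ X* and every x ∈ ∂K with λ(x) = 0, the vector R_λ(x) is tangent to ∂K at x. Assume that R is non-degenerate at every p ∈ X∖{0}, i.e. dim T^R_p = 2 for all p ≠ 0. Then K is symmetric with respect to 0 (K = −K) and the Minkowski norm (gauge) of K is real-analytic on X∖{0}; in particular ∂K is a real-analytic surface. -/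
open Filter Topology

open MeasureTheory in
/-- A function whose derivative is analytic is analytic. -/
lemma analyticAt_of_hasFDerivAt_analytic {E : Type*} [NormedAddCommGroup E] [NormedSpace ℝ E]
    (f : E → ℝ) (α : E → (E →L[ℝ] ℝ)) (x : E) (hα : AnalyticAt ℝ α x)
    (hf : ∀ᶠ y in 𝓝 x, HasFDerivAt f (α y) y) : AnalyticAt ℝ f x := by
  obtain ⟨p, r, hp⟩ := hα
  obtain ⟨ε, hε, hball⟩ := EMetric.mem_nhds_iff.1 hf
  set s := min r ε with hs
  have hspos : 0 < s := lt_min hp.r_pos hε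
  have hp' : HasFPowerSeriesOnBall α p x s := hp.mono hspos (min_le_left _ _)
  let q : FormalMultilinearSeries ℝ E (E →L[ℝ] ℝ) := fun n => ((n : ℝ) + 1)⁻¹ • p n
  have hqr : p.radius ≤ q.radius := by
    apply FormalMultilinearSeries.radius_le_of_le
    intro n
    simp only [q, norm_smul]
    apply mul_le_of_le_one_left (norm_nonneg _)
    rw [Real.norm_of_nonneg (by positivity)]
    apply inv_le_one_of_one_le₀
    have : (0 : ℝ) ≤ n := Nat.cast_nonneg n
    linarith
  have hq0 : 0 < q.radius := lt_of_lt_of_le hspos (hp'.r_le.trans hqr)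
  have hq := (q.hasFPowerSeriesOnBall hq0).comp_sub x
  have hq2 := (hq.unshift (z := f x))
  refine AnalyticAt.congr (f := fun y => f x + q.sum (y - x) (y - x)) ⟨_, ⟨_, by simpa using hq2⟩⟩ ?_
  filter_upwards [Metric.eball_mem_nhds x hspos] with y hy
  obtain ⟨v, rfl⟩ : ∃ v, y = x + v := ⟨y - x, by simp⟩
  simp only [add_sub_cancel_left]
  have hv : v ∈ Metric.eball (0 : E) s := by
    simpa [Metric.mem_eball, edist_eq_enorm_sub] using hy
  have htv : ∀ t ∈ Set.Icc (0 : ℝ) 1, t • v ∈ Metric.eball (0 : E) s := by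
    intro t ht
    rw [mem_eball_zero_iff] at hv ⊢
    refine lt_of_le_of_lt ?_ hv
    rw [enorm_smul]
    refine mul_le_of_le_one_left (by simp) ?_
    rw [Real.enorm_eq_ofReal ht.1]
    simpa using ht.2
  have hxtv : ∀ t ∈ Set.Icc (0 : ℝ) 1, x + t • v ∈ Metric.eball x s := by
    intro t ht
    simpa [Metric.mem_eball, edist_eq_enorm_sub] using htv t ht
  have hder : ∀ t ∈ Set.uIcc (0 : ℝ) 1,
      HasDerivAt (fun t : ℝ => f (x + t • v)) (α (x + t • v) v) t := by
    intro t ht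
    rw [Set.uIcc_of_le zero_le_one] at ht
    have h1 : HasFDerivAt f (α (x + t • v)) (x + t • v) :=
      hball (Metric.eball_subset_eball (min_le_right _ _) (hxtv t ht))
    have h2 : HasDerivAt (fun t : ℝ => x + t • v) v t := by
      simpa using ((hasDerivAt_id t).smul_const v).const_add x
    exact h1.comp_hasDerivAt t h2
  have hcont : ContinuousOn (fun t : ℝ => α (x + t • v) v) (Set.uIcc 0 1) := by
    rw [Set.uIcc_of_le zero_le_one]
    have h1 : ContinuousOn (fun t : ℝ => α (x + t • v)) (Set.Icc 0 1) :=
      hp'.continuousOn.comp (by fun_prop) (fun t ht => hxtv t ht)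
    exact h1.clm_apply continuousOn_const
  have hFTC := intervalIntegral.integral_eq_sub_of_hasDerivAt hder hcont.intervalIntegrable
  have hsum := intervalIntegral.hasSum_integral_of_dominated_convergence (μ := volume)
    (a := (0:ℝ)) (b := 1)
    (F := fun (n : ℕ) (t : ℝ) => t ^ n * (p n (fun _ => v)) v)
    (f := fun t : ℝ => α (x + t • v) v)
    (fun n _ => ‖p n (fun _ => v)‖ * ‖v‖)
    (fun n => by apply Continuous.aestronglyMeasurable; fun_prop)
    (fun n => by
      refine ae_of_all _ fun t ht => ?_
      rw [Set.uIoc_of_le zero_le_one] at ht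
      rw [norm_mul, norm_pow, Real.norm_of_nonneg ht.1.le]
      refine (mul_le_of_le_one_left (norm_nonneg _) (pow_le_one₀ ht.1.le ht.2)).trans ?_
      exact ContinuousLinearMap.le_opNorm _ _)
    (ae_of_all _ fun t _ => (p.summable_norm_apply
      (Metric.eball_subset_eball hp'.r_le hv)).mul_right _)
    intervalIntegrable_const
    (ae_of_all _ fun t ht => by
      rw [Set.uIoc_of_le zero_le_one] at ht
      have h := hp'.hasSum (htv t ⟨ht.1.le, ht.2⟩)
      have h' := (ContinuousLinearMap.apply ℝ ℝ v).hasSum h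
      simpa [ContinuousMultilinearMap.map_smul_univ] using h')
  have hsum2 := (ContinuousLinearMap.apply ℝ ℝ v).hasSum
    (q.hasSum (Metric.eball_subset_eball (hp'.r_le.trans hqr) hv))
  rw [hFTC] at hsum
  have h3 := hsum.unique (a₂ := ContinuousLinearMap.apply ℝ ℝ v (q.sum v)) (by
    convert hsum2 using 2 with n
    simp [q, intervalIntegral.integral_mul_const, integral_pow])
  simp at h3
  linarith

lemma exists_frame {X : Type*} [NormedAddCommGroup X] [NormedSpace ℝ X]
    (hdim : Module.finrank ℝ X = 3)
    (R : Module.Dual ℝ X →ₗ[ℝ] (X →ₗ[ℝ] X)) (p : X)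
    (hnd : Module.finrank ℝ (Submodule.span ℝ (TR R p)) = 2)
    (A : X →L[ℝ] ℝ) (hA : A p = 1) (hA' : ∀ l : Module.Dual ℝ X, l p = 0 → A (R l p) = 0) :
    ∃ (B : Module.Basis (Fin 3) ℝ X) (l₁ l₂ : Module.Dual ℝ X), l₁ p = 0 ∧ l₂ p = 0 ∧
      B 0 = p ∧ B 1 = R l₁ p ∧ B 2 = R l₂ p := by
  have : FiniteDimensional ℝ X := Module.finite_of_finrank_pos (by omega)
  let S : Submodule ℝ X :=
    { carrier := TR R p
      add_mem' := by
        rintro _ _ ⟨l, hl, rfl⟩ ⟨m, hm, rfl⟩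
        exact ⟨l + m, by simp [hl, hm], by simp⟩
      zero_mem' := ⟨0, by simp, by simp⟩
      smul_mem' := by
        rintro c _ ⟨l, hl, rfl⟩
        exact ⟨c • l, by simp [hl], by simp⟩ }
  have hS : Submodule.span ℝ (TR R p) = S := Submodule.span_eq S
  rw [hS] at hnd
  let b := Module.finBasisOfFinrankEq ℝ S hnd
  obtain ⟨l₁, h₁, e₁⟩ := (b 0).2
  obtain ⟨l₂, h₂, e₂⟩ := (b 1).2
  have hli : LinearIndependent ℝ (Fin.cons p (fun i => (b i : X)) : Fin 3 → X) := by
    rw [linearIndependent_finCons]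
    refine ⟨b.linearIndependent.map' S.subtype (by simp), fun h => ?_⟩
    have : p ∈ S := (Submodule.span_le.2 (by rintro _ ⟨i, rfl⟩; exact (b i).2)) h
    obtain ⟨l, hl, e⟩ := this
    have := hA' l hl
    rw [e, hA] at this
    exact one_ne_zero this
  refine ⟨basisOfLinearIndependentOfCardEqFinrank hli (by simp [hdim]), l₁, l₂, h₁, h₂, ?_, ?_, ?_⟩
  · simp
  · rw [coe_basisOfLinearIndependentOfCardEqFinrank]; exact e₁.symm
  · rw [coe_basisOfLinearIndependentOfCardEqFinrank]; exact e₂.symm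

lemma functional_unique {X : Type*} [NormedAddCommGroup X] [NormedSpace ℝ X]
    (hdim : Module.finrank ℝ X = 3)
    (R : Module.Dual ℝ X →ₗ[ℝ] (X →ₗ[ℝ] X)) (p : X)
    (hnd : Module.finrank ℝ (Submodule.span ℝ (TR R p)) = 2)
    (A : X →L[ℝ] ℝ) (hA : A p = 1) (hA' : ∀ l : Module.Dual ℝ X, l p = 0 → A (R l p) = 0)
    (C : X →L[ℝ] ℝ) (hC : C p = 1) (hC' : ∀ l : Module.Dual ℝ X, l p = 0 → C (R l p) = 0) :
    A = C := by
  obtain ⟨B, l₁, l₂, h₁, h₂, e0, e1, e2⟩ := exists_frame hdim R p hnd A hA hA'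
  have : (A : X →ₗ[ℝ] ℝ) = C := by
    apply B.ext
    intro i
    fin_cases i
    · simp [e0, hA, hC]
    · simp [e1, hA' l₁ h₁, hC' l₁ h₁]
    · simp [e2, hA' l₂ h₂, hC' l₂ h₂]
  exact ContinuousLinearMap.coe_injective this

lemma functional_analytic {X : Type*} [NormedAddCommGroup X] [NormedSpace ℝ X]
    (hdim : Module.finrank ℝ X = 3)
    (R : Module.Dual ℝ X →ₗ[ℝ] (X →ₗ[ℝ] X)) (p : X) (hp : p ≠ 0)
    (hnd : Module.finrank ℝ (Submodule.span ℝ (TR R p)) = 2)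
    (A : X → (X →L[ℝ] ℝ)) (hA : ∀ q ≠ 0, A q q = 1)
    (hA' : ∀ q ≠ 0, ∀ l : Module.Dual ℝ X, l q = 0 → A q (R l q) = 0) :
    AnalyticAt ℝ A p := by
  have : FiniteDimensional ℝ X := Module.finite_of_finrank_pos (by omega)
  have : CompleteSpace X := FiniteDimensional.complete ℝ X
  obtain ⟨B, l₁, l₂, h₁, h₂, e0, e1, e2⟩ := exists_frame hdim R p hnd (A p) (hA p hp) (hA' p hp)
  let c : Fin 3 → (X →L[ℝ] ℝ) := fun i => LinearMap.toContinuousLinearMap (B.coord i)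
  let m₁ : X →L[ℝ] ℝ := LinearMap.toContinuousLinearMap l₁
  let m₂ : X →L[ℝ] ℝ := LinearMap.toContinuousLinearMap l₂
  let r₀ : X →L[ℝ] X := LinearMap.toContinuousLinearMap (R (B.coord 0))
  let r₁ : X →L[ℝ] X := LinearMap.toContinuousLinearMap (R l₁)
  let r₂ : X →L[ℝ] X := LinearMap.toContinuousLinearMap (R l₂)
  let w₁ : X → X := fun q => c 0 q • r₁ q - m₁ q • r₀ q
  let w₂ : X → X := fun q => c 0 q • r₂ q - m₂ q • r₀ q
  let M : X → (X →L[ℝ] X) := fun q =>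
    (c 0).smulRight q + (c 1).smulRight (w₁ q) + (c 2).smulRight (w₂ q)
  have hc0 : c 0 p = 1 := by simp [c, ← e0]
  have hM1 : M p = 1 := by
    apply ContinuousLinearMap.coe_injective
    apply B.ext
    have a1 : w₁ p = B 1 := by simp [w₁, hc0, m₁, h₁, r₁, e1]
    have a2 : w₂ p = B 2 := by simp [w₂, hc0, m₂, h₂, r₂, e2]
    intro i
    rw [← e0] at a1 a2
    fin_cases i <;> simp [M, c, a1, a2, ← e0]
  have hw₁ : AnalyticAt ℝ w₁ p :=
    (((c 0).analyticAt p).smul (r₁.analyticAt p)).sub ((m₁.analyticAt p).smul (r₀.analyticAt p))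
  have hw₂ : AnalyticAt ℝ w₂ p :=
    (((c 0).analyticAt p).smul (r₂.analyticAt p)).sub ((m₂.analyticAt p).smul (r₀.analyticAt p))
  have hM : AnalyticAt ℝ M p := by
    have key : ∀ (d : X →L[ℝ] ℝ) (w : X → X), AnalyticAt ℝ w p →
        AnalyticAt ℝ (fun q => d.smulRight (w q)) p := by
      intro d w hw
      exact ((ContinuousLinearMap.smulRightL ℝ X X d).analyticAt _).comp hw
    exact ((key _ _ analyticAt_id).add (key _ _ hw₁)).add (key _ _ hw₂)
  have hinv : AnalyticAt ℝ (fun q => Ring.inverse (M q)) p := by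
    have h := analyticAt_inverse (𝕜 := ℝ) (1 : (X →L[ℝ] X)ˣ)
    rw [Units.val_one, ← hM1] at h
    exact h.comp hM
  have hfin : AnalyticAt ℝ (fun q => (c 0).comp (Ring.inverse (M q))) p :=
    ((ContinuousLinearMap.compL ℝ X X ℝ (c 0)).analyticAt _).comp hinv
  refine hfin.congr ?_
  have hunit : ∀ᶠ q in 𝓝 p, IsUnit (M q) :=
    hM.continuousAt.eventually (Units.isOpen.mem_nhds (by rw [hM1]; exact isUnit_one))
  filter_upwards [hunit, isOpen_ne.mem_nhds hp] with q hq hq0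
  have hcomp : (A q).comp (M q) = c 0 := by
    have b1 : A q (w₁ q) = 0 := by
      have := hA' q hq0 (c 0 q • l₁ - m₁ q • B.coord 0) (by simp [c, m₁]; ring)
      simpa [w₁, r₁, r₀] using this
    have b2 : A q (w₂ q) = 0 := by
      have := hA' q hq0 (c 0 q • l₂ - m₂ q • B.coord 0) (by simp [c, m₂]; ring)
      simpa [w₂, r₂, r₀] using this
    ext v
    simp [M, b1, b2, hA q hq0]
  rw [← hcomp, ContinuousLinearMap.comp_assoc]
  have : (M q).comp (Ring.inverse (M q)) = 1 := Ring.mul_inverse_cancel _ hq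
  rw [this]; rfl

/-- **Lemma (symmetry and analyticity in the non-degenerate case).**  Let `dim X = 3`,
`K ⊂ X` a convex body with `0` in its interior and `R : X* → End(X)` a linear map with
trace-free values satisfying the tangency assumption: `R_λ(x)` is tangent to `∂K` at `x`
whenever `x ∈ ∂K` and `λ(x) = 0`.  If `R` is non-degenerate at every `p ≠ 0`, i.e.
`dim T^R_p = 2` for all `p ≠ 0`, then `K` is symmetric with respect to `0` and the Minkowski
norm (gauge) of `K` is real-analytic on `X ∖ {0}` (so `∂K` is a real-analytic surface). -/
theorem symmetric_and_analytic_of_nondegenerate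
    {X : Type*} [NormedAddCommGroup X] [NormedSpace ℝ X]
    (hdim : Module.finrank ℝ X = 3)
    (K : Set X) (hKcomp : IsCompact K) (hKconv : Convex ℝ K)
    (h0 : (0 : X) ∈ interior K)
    (R : Module.Dual ℝ X →ₗ[ℝ] (X →ₗ[ℝ] X))
    (htr : ∀ lam : Module.Dual ℝ X, LinearMap.trace ℝ X (R lam) = 0)
    (htang : ∀ lam : Module.Dual ℝ X, ∀ x ∈ frontier K, lam x = 0 →
      IsTangentVec K x (R lam x))
    (hnondeg : ∀ p : X, p ≠ 0 → Module.finrank ℝ (Submodule.span ℝ (TR R p)) = 2) :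
    (∀ x, x ∈ K ↔ -x ∈ K) ∧ AnalyticOnNhd ℝ (gauge K) {x : X | x ≠ 0} := by
  have hfd : FiniteDimensional ℝ X := Module.finite_of_finrank_pos (by omega)
  have hK0 : K ∈ 𝓝 (0 : X) := mem_interior_iff_mem_nhds.1 h0
  have habs : Absorbent ℝ K := absorbent_nhds_zero hK0
  have hbdd : Bornology.IsVonNBounded ℝ K := hKcomp.isVonNBounded ℝ
  have hpos : ∀ x : X, x ≠ 0 → 0 < gauge K x := fun x hx => (gauge_pos habs hbdd).2 hx
  have hcont : Continuous (gauge K) := continuous_gauge hKconv hK0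
  -- subgradients exist
  have hex : ∀ p : X, ∃ l : X →L[ℝ] ℝ, p ≠ 0 → (l p = gauge K p ∧ ∀ x, l x ≤ gauge K x) := by
    intro p
    by_cases hp : p = 0
    · exact ⟨0, fun h => absurd hp h⟩
    obtain ⟨g, hg, hg'⟩ := exists_extension_of_le_sublinear
      (LinearPMap.mkSpanSingleton p (gauge K p) hp) (gauge K)
      (fun c hc x => gauge_smul_of_nonneg hc.le x) (gauge_add_le hKconv habs) (by
        rintro ⟨x, hx⟩
        obtain ⟨c, rfl⟩ := Submodule.mem_span_singleton.1 hx
        erw [LinearPMap.mkSpanSingleton'_apply]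
        simp only [smul_eq_mul, RingHom.id_apply]
        rcases le_or_gt 0 c with h | h
        · rw [gauge_smul_of_nonneg h, smul_eq_mul]
        · exact (mul_nonpos_of_nonpos_of_nonneg h.le (gauge_nonneg _)).trans (gauge_nonneg _))
    refine ⟨LinearMap.toContinuousLinearMap g, fun _ => ⟨?_, fun x => hg' x⟩⟩
    have := hg ⟨p, Submodule.mem_span_singleton_self p⟩
    rw [LinearPMap.mkSpanSingleton_apply] at this
    simpa using this
  choose b hb using hex
  -- they vanish on forward tangent vectors
  have hft : ∀ p ∈ frontier K, ∀ v, IsForwardTangent K p v → ∀ l : X →L[ℝ] ℝ, l p = 1 →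
      (∀ x, l x ≤ gauge K x) → l v ≤ 0 := by
    rintro p hp v ⟨s, c, hs, hc, -, hlim⟩ l hl hle
    refine le_of_tendsto ((l.continuous.tendsto v).comp hlim) (Eventually.of_forall fun i => ?_)
    have h1 := hle (s i)
    rw [(gauge_eq_one_iff_mem_frontier hKconv hK0).2 (hs i)] at h1
    simp only [Function.comp, map_smul, map_sub, smul_eq_mul, hl]
    exact mul_nonpos_of_nonneg_of_nonpos (hc i).le (by linarith)
  have hbT : ∀ p ≠ 0, ∀ l : Module.Dual ℝ X, l p = 0 → b p (R l p) = 0 := by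
    intro p hp l hl
    obtain ⟨h1, h2⟩ := hb p hp
    have hg := hpos p hp
    set x := (gauge K p)⁻¹ • p with hx
    have hxf : x ∈ frontier K := by
      rw [← gauge_eq_one_iff_mem_frontier hKconv hK0, hx, gauge_smul_of_nonneg (by positivity)]
      exact inv_mul_cancel₀ hg.ne'
    have hbx : b p x = 1 := by
      rw [hx, map_smul, h1]
      exact inv_mul_cancel₀ hg.ne'
    obtain ⟨t1, t2⟩ := htang l x hxf (by simp [hx, hl])
    have u1 := hft x hxf _ t1 (b p) hbx h2
    have u2 := hft x hxf _ t2 (b p) hbx h2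
    have u3 : b p (R l x) = 0 := by
      rw [map_neg] at u2
      linarith
    rw [hx] at u3
    simpa [hg.ne'] using u3
  let A : X → (X →L[ℝ] ℝ) := fun p => (gauge K p)⁻¹ • b p
  have hA1 : ∀ q ≠ 0, A q q = 1 := by
    intro q hq
    simp [A, (hb q hq).1, (hpos q hq).ne']
  have hA2 : ∀ q ≠ 0, ∀ l : Module.Dual ℝ X, l q = 0 → A q (R l q) = 0 := by
    intro q hq l hl
    simp [A, hbT q hq l hl]
  have hAan : ∀ p ≠ 0, AnalyticAt ℝ A p := fun p hp =>
    functional_analytic hdim R p hp (hnondeg p hp) A hA1 hA2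
  have hAneg : ∀ p ≠ 0, A (-p) = - A p := by
    intro p hp
    have hp' : -p ≠ 0 := neg_ne_zero.2 hp
    have := functional_unique hdim R p (hnondeg p hp) (A p) (hA1 p hp) (hA2 p hp) (-A (-p))
      (by have := hA1 _ hp'; simpa using this)
      (fun l hl => by have := hA2 _ hp' l (by simpa using hl); simpa using this)
    rw [this, neg_neg]
  have hbcont : ∀ p ≠ 0, ContinuousAt b p := by
    intro p hp
    have h : ContinuousAt (fun q => gauge K q • A q) p :=
      hcont.continuousAt.smul (hAan p hp).continuousAt
    refine h.congr ?_
    filter_upwards [isOpen_ne.mem_nhds hp] with q hq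
    simp [A, smul_smul, (hpos q hq).ne']
  have hder : ∀ p ≠ 0, HasFDerivAt (gauge K) (b p) p := by
    intro p hp
    rw [hasFDerivAt_iff_isLittleO, Asymptotics.isLittleO_iff]
    intro c hc
    have h1 : ∀ᶠ q in 𝓝 p, ‖b q - b p‖ < c := by
      have := Metric.continuousAt_iff'.1 (hbcont p hp) c hc
      simpa [dist_eq_norm] using this
    filter_upwards [h1, isOpen_ne.mem_nhds hp] with q hq hq0
    obtain ⟨p1, p2⟩ := hb p hp
    obtain ⟨q1, q2⟩ := hb q hq0
    have i1 := p2 q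
    have i2 := q2 p
    have i3 : (b q - b p) (q - p) ≤ c * ‖q - p‖ :=
      (le_abs_self _).trans (((b q - b p).le_opNorm (q - p)).trans
        (mul_le_mul_of_nonneg_right hq.le (norm_nonneg _)))
    simp only [sub_apply, map_sub] at i3 ⊢
    rw [Real.norm_eq_abs, abs_le]
    have : 0 ≤ c * ‖q - p‖ := by positivity
    constructor <;> linarith
  have hlog : ∀ p ≠ 0, HasFDerivAt (fun q => Real.log (gauge K q)) (A p) p := fun p hp =>
    (hder p hp).log (hpos p hp).ne'
  constructor
  · -- symmetry
    have hrank : 1 < Module.rank ℝ X := by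
      rw [← Module.finrank_eq_rank, hdim]
      norm_num
    have hconn := (isConnected_compl_singleton_of_one_lt_rank hrank (0 : X)).isPreconnected
    have hD : ∀ p ≠ 0, HasFDerivAt
        (fun q => Real.log (gauge K q) - Real.log (gauge K (-q))) (0 : X →L[ℝ] ℝ) p := by
      intro p hp
      have h2 : HasFDerivAt (fun q : X => -q) (-ContinuousLinearMap.id ℝ X) p :=
        (hasFDerivAt_id p).neg
      have h3 := (hlog p hp).sub ((hlog (-p) (neg_ne_zero.2 hp)).comp p h2)
      convert! h3 using 1
      rw [hAneg p hp]
      ext v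
      simp
    have hsym : ∀ p ≠ 0, gauge K p = gauge K (-p) := by
      intro p hp
      have hp' : -p ≠ 0 := neg_ne_zero.2 hp
      have := (isOpen_compl_singleton (x := (0 : X))).is_const_of_fderiv_eq_zero (𝕜 := ℝ) hconn
        (fun q hq => (hD q hq).differentiableAt.differentiableWithinAt)
        (fun q hq => (hD q hq).fderiv) (x := p) (y := -p) hp hp'
      simp only [neg_neg] at this
      exact Real.log_injOn_pos (hpos p hp) (hpos _ hp') (by linarith)
    have hmem : ∀ x, x ∈ K ↔ gauge K x ≤ 1 := by
      intro x
      rw [gauge_le_one_iff_mem_closure hKconv hK0, hKcomp.isClosed.closure_eq]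
    intro x
    by_cases hx : x = 0
    · simp [hx]
    · rw [hmem, hmem, hsym x hx]
  · intro p hp
    have h1 : AnalyticAt ℝ (fun q => Real.log (gauge K q)) p := by
      refine analyticAt_of_hasFDerivAt_analytic _ A p (hAan p hp) ?_
      filter_upwards [isOpen_ne.mem_nhds hp] with q hq
      exact hlog q hq
    refine h1.rexp.congr ?_
    filter_upwards [isOpen_ne.mem_nhds hp] with q hq
    exact Real.exp_log (hpos q hq)
end
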